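/- arXiv:1306.0828 — 5 statements merged into one kernel-verified Lean document; each statement's English description precedes it below -/
import Mathlib

section
/- Fix k ≥ 1 and exponents a₀,…,a_{k−1} ∈ ℕ, and let R be a Noetherian commutative ring. Let Y be the set of variables y_J indexed by injective tuples J = (j₀,…,j_{k−1}) ∈ ℕ^k, and let φ : R[Y] → R[x_j : j ∈ ℕ] be the R-algebra homomorphism with φ(y_J) = x_{j₀}^{a₀} ⋯ x_{j_{k−1}}^{a_{k−1}}. Let Inc(ℕ) act by R-algebra endomorphisms on R[Y] via π·y_J = y_{(π(j₀),…,π(j_{k−1}))} and on R[x_j : j ∈ ℕ] via π·x_j = x_{π(j)}. Then ker φ is generated as an ideal of R[Y] by the union of finitely many Inc(ℕ)-orbits of binomials (differences of two monomials in the variables y_J). -/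
open MvPolynomial

/-- The index set of the variables `y_J`: injective tuples `J ∈ ℕ^k`. -/
def InjTuple (k : ℕ) : Type := {J : Fin k → ℕ // Function.Injective J}

/-- The monomial map `φ : R[Y] → R[x_j : j ∈ ℕ]`, `y_J ↦ x_{J 0}^{a 0} ⋯ x_{J (k-1)}^{a (k-1)}`. -/
noncomputable def tupleMap (k : ℕ) (a : Fin k → ℕ) (R : Type) [CommRing R] :
    MvPolynomial (InjTuple k) R →ₐ[R] MvPolynomial ℕ R :=
  aeval fun J : InjTuple k => ∏ i, (X (J.1 i) : MvPolynomial ℕ R) ^ a i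

/-- The action of a strictly increasing map `π : ℕ → ℕ` on the index set `Y`:
`π · y_J = y_{π ∘ J}`. -/
def incTuple {k : ℕ} (π : ℕ → ℕ) (hπ : StrictMono π) (J : InjTuple k) : InjTuple k :=
  ⟨π ∘ J.1, hπ.injective.comp J.2⟩

/-- `FlaggedEmbedding L l l'` says that `l` is pointwise below a sublist of `l'`, where flags are
preserved and every letter of `l'` outside that sublist is unflagged. -/
inductive FlaggedEmbedding {β : Type*} [LE β] (L : β → Bool) : List β → List β → Prop
  | nil : FlaggedEmbedding L [] []
  | skip {b : β} {l l' : List β} :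
      L b = false → FlaggedEmbedding L l l' → FlaggedEmbedding L l (b :: l')
  | cons {b b' : β} {l l' : List β} :
      b ≤ b' → L b = L b' → FlaggedEmbedding L l l' → FlaggedEmbedding L (b :: l) (b' :: l')

namespace FlaggedEmbedding

theorem append {β : Type*} [LE β] {L : β → Bool} {p p' q q' : List β}
    (h : FlaggedEmbedding L p p') (h' : FlaggedEmbedding L q q') :
    FlaggedEmbedding L (p ++ q) (p' ++ q') := by
  induction h with
  | nil => exact h'
  | skip hb _ ih => exact skip hb ih
  | cons hb hL _ ih => exact cons hb hL ih

theorem of_sublistForall₂ {β : Type*} [LE β] {L : β → Bool} {l l' : List β}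
    (h : List.SublistForall₂ (· ≤ ·) l l') (hl : ∀ x ∈ l, L x = false)
    (hl' : ∀ x ∈ l', L x = false) : FlaggedEmbedding L l l' := by
  induction h with
  | @nil l =>
    induction l with
    | nil => exact nil
    | cons b l ih =>
      exact skip (hl' b (by simp)) (ih fun x hx => hl' x (by simp [hx]))
  | cons hb _ ih =>
    refine cons hb ?_ (ih (fun x hx => hl x (by simp [hx])) fun x hx => hl' x (by simp [hx]))
    rw [hl _ (by simp), hl' _ (by simp)]
  | cons_right _ ih =>
    exact skip (hl' _ (by simp)) (ih hl fun x hx => hl' x (by simp [hx]))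

/-- Words with a bounded number of flagged letters are well-quasi-ordered by flagged embedding. -/
theorem partiallyWellOrderedOn {β : Type*} [Preorder β] [WellQuasiOrderedLE β] (L : β → Bool)
    (K : ℕ) : {l : List β | l.countP L ≤ K}.PartiallyWellOrderedOn (FlaggedEmbedding L) := by
  have hfalse : {l : List β | ∀ x ∈ l, x ∈ {x | L x = false}}.PartiallyWellOrderedOn
      (List.SublistForall₂ (· ≤ ·)) :=
    Set.PartiallyWellOrderedOn.partiallyWellOrderedOn_sublistForall₂ _
      (Set.isPWO_of_wellQuasiOrderedLE _)
  have hbase : {l : List β | ∀ x ∈ l, L x = false}.PartiallyWellOrderedOn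
      (FlaggedEmbedding L) := by
    have := hfalse.image_of_monotone_on (f := id) (r' := FlaggedEmbedding L)
      fun l hl l' hl' h => of_sublistForall₂ h hl hl'
    simpa using this
  induction K with
  | zero => simpa [List.countP_eq_zero] using hbase
  | succ K ih =>
    have : IsPreorder (List β) (List.SublistForall₂ (· ≤ ·)) := {}
    have hprod := hfalse.prod (Set.PartiallyWellOrderedOn.prod (r := (· ≤ ·))
      (Set.isPWO_of_wellQuasiOrderedLE {x : β | L x = true}) ih)
    have hsplit := hprod.image_of_monotone_on (f := fun t => t.1 ++ t.2.1 :: t.2.2)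
      (r' := FlaggedEmbedding L) (by
        rintro ⟨p, b, q⟩ ⟨hp, hb, -⟩ ⟨p', b', q'⟩ ⟨hp', hb', -⟩ ⟨h₁, h₂, h₃⟩
        exact (of_sublistForall₂ h₁ hp hp').append (cons h₂ (hb.trans hb'.symm) h₃))
    refine (hbase.union hsplit).mono ?_
    intro l hl
    induction l with
    | nil => left; simp
    | cons b l ihl =>
      by_cases hb : L b = true
      · right
        refine ⟨([], b, l), ⟨by simp, hb, ?_⟩, rfl⟩
        simpa [hb] using hl
      · have hb' : L b = false := by simpa using hb
        rcases ihl (by simpa [hb'] using hl) with h | ⟨⟨p, c, q⟩, ⟨hp, hc, hq⟩, rfl⟩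
        · left
          simpa [hb'] using h
        · right
          refine ⟨(b :: p, c, q), ⟨?_, hc, hq⟩, rfl⟩
          intro x hx
          rcases List.mem_cons.1 hx with rfl | hx
          · exact hb'
          · exact hp x hx

theorem exists_strictMono {β : Type*} [Preorder β] {L : β → Bool} {l l' : List β}
    (h : FlaggedEmbedding L l l') (z : β) :
    ∃ π : ℕ → ℕ, StrictMono π ∧
      (∀ j, l.getD j z ≤ l'.getD (π j) z ∧ L (l.getD j z) = L (l'.getD (π j) z)) ∧
      ∀ j, j ∉ Set.range π → L (l'.getD j z) = false := by
  induction h with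
  | nil => exact ⟨id, strictMono_id, by simp, by simp⟩
  | skip hb _ ih =>
    obtain ⟨π, hπ, h₁, h₂⟩ := ih
    refine ⟨fun j => π j + 1, fun i j hij => by simpa using hπ hij, by simpa using h₁, ?_⟩
    rintro (_ | j) hj
    · simpa using hb
    · simpa using h₂ j (by simpa using hj)
  | cons hb hL _ ih =>
    obtain ⟨π, hπ, h₁, h₂⟩ := ih
    refine ⟨fun j => j.casesOn 0 fun j => π j + 1, ?_, ?_, ?_⟩
    · rintro (_ | i) (_ | j) hij
      · omega
      · simp
      · omega
      · simpa using hπ (Nat.lt_of_succ_lt_succ hij)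
    · rintro (_ | j)
      · simpa using ⟨hb, hL⟩
      · simpa using h₁ j
    · rintro (_ | j) hj
      · exact absurd ⟨0, rfl⟩ hj
      · refine h₂ j ?_
        rintro ⟨i, rfl⟩
        exact hj ⟨i + 1, rfl⟩

end FlaggedEmbedding

/-- The `i`-th component of `countMat u` counts how often each index occurs at position `i` in the
tuples of the multiset `u`. -/
noncomputable def countMat {k : ℕ} : (InjTuple k →₀ ℕ) →+ (Fin k → ℕ →₀ ℕ) :=
  AddMonoidHom.pi fun i => Finsupp.mapDomain.addMonoidHom fun J : InjTuple k => J.1 i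

section countMat

variable {k : ℕ}

theorem countMat_apply (u : InjTuple k →₀ ℕ) (i : Fin k) :
    countMat u i = u.mapDomain fun J => J.1 i := rfl

theorem countMat_single (J : InjTuple k) (n : ℕ) (i : Fin k) :
    countMat (Finsupp.single J n) i = Finsupp.single (J.1 i) n := by
  rw [countMat_apply, Finsupp.mapDomain_single]

theorem degree_countMat (u : InjTuple k →₀ ℕ) (i : Fin k) :
    (countMat u i).degree = u.degree := by
  rw [countMat_apply, Finsupp.degree_mapDomain]

theorem sum_countMat_single_le (J : InjTuple k) (j : ℕ) :
    ∑ i, countMat (Finsupp.single J 1) i j ≤ 1 := by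
  simp only [countMat_single, Finsupp.single_apply]
  rw [Finset.sum_boole, Nat.cast_id, Finset.card_le_one]
  intro i hi i' hi'
  simp only [Finset.mem_filter] at hi hi'
  exact J.2 (hi.2.trans hi'.2.symm)

theorem sum_countMat_le (u : InjTuple k →₀ ℕ) (j : ℕ) : ∑ i, countMat u i j ≤ u.degree := by
  induction u using Finsupp.induction_linear with
  | zero => simp
  | add u v hu hv =>
    simp only [map_add, Pi.add_apply, Finsupp.add_apply, Finset.sum_add_distrib]
    exact add_le_add hu hv
  | single J n =>
    have h : Finsupp.single J n = n • Finsupp.single J 1 := by simp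
    rw [h]
    simp only [map_nsmul, Pi.smul_apply, Finsupp.smul_apply, ← Finset.smul_sum]
    simpa using Nat.mul_le_mul_left n (sum_countMat_single_le J j)

theorem countMat_mapDomain_incTuple (π : ℕ → ℕ) (hπ : StrictMono π) (u : InjTuple k →₀ ℕ)
    (i : Fin k) :
    countMat (u.mapDomain (incTuple π hπ)) i = (countMat u i).mapDomain π := by
  rw [countMat_apply, countMat_apply, ← Finsupp.mapDomain_comp, ← Finsupp.mapDomain_comp]
  rfl

/-- A square matrix with constant positive line sums has a nonzero transversal. -/
theorem exists_injective_of_sum_eq {ι : Type*} [Fintype ι] (M : ι → ι → ℕ) {d : ℕ} (hd : 0 < d)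
    (hr : ∀ i, ∑ j, M i j = d) (hc : ∀ j, ∑ i, M i j = d) :
    ∃ σ : ι → ι, Function.Injective σ ∧ ∀ i, M i (σ i) ≠ 0 := by
  classical
  let f (i : ι) : Finset ι := {j | M i j ≠ 0}
  obtain ⟨σ, hσ, h⟩ := (Finset.all_card_le_biUnion_card_iff_exists_injective f).1 (by
    intro s
    refine Nat.le_of_mul_le_mul_right ?_ hd
    calc s.card * d = ∑ i ∈ s, ∑ j, M i j := by simp [hr]
      _ = ∑ i ∈ s, ∑ j ∈ s.biUnion f, M i j := by
        refine Finset.sum_congr rfl fun i hi => (Finset.sum_subset (Finset.subset_univ _) ?_).symm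
        intro j _ hj
        by_contra hne
        exact hj (Finset.mem_biUnion.2 ⟨i, hi, by simpa [f] using hne⟩)
      _ = ∑ j ∈ s.biUnion f, ∑ i ∈ s, M i j := Finset.sum_comm
      _ ≤ ∑ j ∈ s.biUnion f, ∑ i, M i j :=
        Finset.sum_le_sum fun j _ => Finset.sum_le_univ_sum_of_nonneg fun _ => Nat.zero_le _
      _ = (s.biUnion f).card * d := by simp [hc])
  exact ⟨σ, hσ, fun i => by simpa [f] using h i⟩

theorem exists_forall_apply_eq_zero (A : Fin k → ℕ →₀ ℕ) :
    ∃ n, ∀ i j, n ≤ j → A i j = 0 := by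
  classical
  refine ⟨(Finset.univ.biUnion fun i => (A i).support).sup id + 1, fun i j hj => ?_⟩
  by_contra h
  have : id j ≤ (Finset.univ.biUnion fun i => (A i).support).sup id :=
    Finset.le_sup (Finset.mem_biUnion.2 ⟨i, Finset.mem_univ _, Finsupp.mem_support_iff.2 h⟩)
  simp only [id] at this
  omega

theorem degree_eq_sum_fin {n : ℕ} {v : ℕ →₀ ℕ} (h : ∀ j, n ≤ j → v j = 0) :
    v.degree = ∑ j : Fin n, v j := by
  rw [Fin.sum_univ_eq_sum_range, Finsupp.degree_apply]
  refine Finset.sum_subset (fun j hj => ?_) fun j _ hj => Finsupp.notMem_support_iff.1 hj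
  by_contra hn
  exact Finsupp.mem_support_iff.1 hj (h j (by simpa using hn))

/-- A matrix with row sums `d` and column sums at most `d` has a transversal of nonzero entries
meeting all columns with sum `d`. -/
theorem exists_transversal (A : Fin k → ℕ →₀ ℕ) {d : ℕ} (hd : 0 < d)
    (hr : ∀ i, (A i).degree = d) (hc : ∀ j, ∑ i, A i j ≤ d) :
    ∃ r : InjTuple k, (∀ i, A i (r.1 i) ≠ 0) ∧ ∀ j, ∑ i, A i j = d → ∃ i, r.1 i = j := by
  classical
  obtain ⟨n, hn⟩ := exists_forall_apply_eq_zero A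
  let M : Fin k ⊕ Fin n → Fin k ⊕ Fin n → ℕ := fun x y =>
    match x, y with
    | .inl _, .inl _ => 0
    | .inl i, .inr j => A i j
    | .inr j, .inl i => A i j
    | .inr j, .inr j' => if j = j' then d - ∑ i, A i j else 0
  have hsymm : ∀ x y, M x y = M y x := by
    rintro (i | j) (i' | j')
    · rfl
    · rfl
    · rfl
    · by_cases h : j = j'
      · subst h; rfl
      · simp [M, h, Ne.symm h]
  have hrow : ∀ x, ∑ y, M x y = d := by
    rintro (i | j)
    · simp only [Fintype.sum_sum_type, M]
      rw [Finset.sum_const_zero, zero_add, ← degree_eq_sum_fin (hn i), hr]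
    · simp only [Fintype.sum_sum_type, M]
      rw [Finset.sum_ite_eq, if_pos (Finset.mem_univ _)]
      have := hc j
      omega
  obtain ⟨σ, hσ, hne⟩ := exists_injective_of_sum_eq M hd hrow fun y => by
    rw [← hrow y]
    exact Finset.sum_congr rfl fun x _ => hsymm x y
  have hinl : ∀ i, ∃ j : Fin n, σ (.inl i) = .inr j := by
    intro i
    rcases h : σ (.inl i) with i' | j
    · exact absurd rfl (h ▸ hne (.inl i))
    · exact ⟨j, rfl⟩
  choose ρ hρ using hinl
  refine ⟨⟨fun i => ρ i, fun i i' h => ?_⟩, fun i => ?_, fun j hj => ?_⟩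
  · refine Sum.inl_injective (hσ ?_)
    rw [hρ, hρ, Fin.ext h]
  · have := hne (.inl i)
    rw [hρ] at this
    exact this
  · have hjn : j < n := by
      by_contra h
      rw [Finset.sum_eq_zero fun i _ => hn i j (not_lt.1 h)] at hj
      omega
    obtain ⟨x, hx⟩ := (Finite.injective_iff_surjective.1 hσ) (.inr ⟨j, hjn⟩)
    rcases x with i | j'
    · refine ⟨i, ?_⟩
      rw [hρ] at hx
      exact congrArg Fin.val (Sum.inr_injective hx)
    · have h := hne (.inr j')
      rw [hx] at h
      simp only [M] at h
      split_ifs at h with hjj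
      · subst hjj
        simp only at h
        omega
      · exact absurd rfl h

/-- **König's edge colouring theorem** for the multigraphs with incidence matrix `A`: the matrices
of the form `countMat u` are those with constant row sums bounding the column sums. -/
theorem exists_countMat_eq (d : ℕ) (A : Fin k → ℕ →₀ ℕ) (hr : ∀ i, (A i).degree = d)
    (hc : ∀ j, ∑ i, A i j ≤ d) : ∃ u : InjTuple k →₀ ℕ, countMat u = A := by
  induction d generalizing A with
  | zero =>
    refine ⟨0, ?_⟩
    rw [map_zero]
    funext i
    exact ((Finsupp.degree_eq_zero_iff _).1 (hr i)).symm
  | succ d ih =>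
    obtain ⟨r, hr0, hrt⟩ := exists_transversal A d.succ_pos hr hc
    have hsub : countMat (Finsupp.single r 1) ≤ A := by
      intro i
      rw [countMat_single, Finsupp.single_le_iff]
      exact Nat.one_le_iff_ne_zero.2 (hr0 i)
    obtain ⟨C, rfl⟩ := exists_add_of_le hsub
    obtain ⟨u, hu⟩ := ih C (fun i => by
      have := hr i
      rw [Pi.add_apply, map_add, degree_countMat, Finsupp.degree_single] at this
      omega) (fun j => by
      have h := hc j
      have ht := hrt j
      simp only [Pi.add_apply, Finsupp.add_apply, Finset.sum_add_distrib] at h ht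
      by_cases hj : ∑ i, countMat (Finsupp.single r 1) i j + ∑ i, C i j = d + 1
      · obtain ⟨i, rfl⟩ := ht hj
        have h1 : countMat (Finsupp.single r 1) i (r.1 i) ≤
            ∑ i', countMat (Finsupp.single r 1) i' (r.1 i) :=
          Finset.single_le_sum (f := fun i' => countMat (Finsupp.single r 1) i' (r.1 i))
            (fun _ _ => Nat.zero_le _) (Finset.mem_univ i)
        rw [countMat_single, Finsupp.single_eq_same] at h1
        omega
      · omega)
    exact ⟨Finsupp.single r 1 + u, by rw [map_add, hu]⟩

end countMat

section Exchange

variable {k : ℕ}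

theorem exists_mem_support_of_countMat_ne_zero {u : InjTuple k →₀ ℕ} {i : Fin k} {j : ℕ}
    (h : countMat u i j ≠ 0) : ∃ J ∈ u.support, J.1 i = j := by
  classical
  rw [countMat_apply, ← Finsupp.mem_support_iff] at h
  exact Finset.mem_image.1 (Finsupp.mapDomain_support h)

theorem countMat_apply_ne_zero {u : InjTuple k →₀ ℕ} {J : InjTuple k} (hJ : J ∈ u.support)
    (i : Fin k) : countMat u i (J.1 i) ≠ 0 := by
  have hle : Finsupp.single J 1 ≤ u :=
    Finsupp.single_le_iff.2 (Nat.one_le_iff_ne_zero.2 (Finsupp.mem_support_iff.1 hJ))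
  obtain ⟨t, rfl⟩ := exists_add_of_le hle
  rw [map_add, Pi.add_apply, Finsupp.add_apply, countMat_single, Finsupp.single_eq_same]
  omega

theorem degree_le_sum_countMat {u : InjTuple k →₀ ℕ} {j : ℕ}
    (h : ∀ J ∈ u.support, j ∈ Set.range J.1) : u.degree ≤ ∑ i, countMat u i j := by
  simp only [countMat_apply, Finsupp.mapDomain, Finsupp.sum_apply, Finsupp.degree_apply]
  simp only [Finsupp.sum]
  rw [Finset.sum_comm]
  refine Finset.sum_le_sum fun J hJ => ?_
  obtain ⟨i, rfl⟩ := h J hJ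
  refine le_trans (le_of_eq ?_) (Finset.single_le_sum
    (f := fun i' => (Finsupp.single (J.1 i') (u J) : ℕ →₀ ℕ) (J.1 i))
    (fun _ _ => Nat.zero_le _) (Finset.mem_univ i))
  simp

theorem sum_countMat_lt {u : InjTuple k →₀ ℕ} {J : InjTuple k} (hJ : J ∈ u.support) {j : ℕ}
    (h : j ∉ Set.range J.1) : ∑ i, countMat u i j < u.degree := by
  have hle : Finsupp.single J 1 ≤ u :=
    Finsupp.single_le_iff.2 (Nat.one_le_iff_ne_zero.2 (Finsupp.mem_support_iff.1 hJ))
  obtain ⟨t, rfl⟩ := exists_add_of_le hle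
  simp only [map_add, Pi.add_apply, Finsupp.add_apply, Finset.sum_add_distrib,
    Finsupp.degree_single]
  have h0 : ∑ i, countMat (Finsupp.single J 1) i j = 0 :=
    Finset.sum_eq_zero fun i _ => by
      rw [countMat_single, Finsupp.single_eq_of_ne]
      rintro rfl
      exact h ⟨i, rfl⟩
  have := sum_countMat_le t j
  omega

/-- If `r` occurs in some multiset with the same counts as `u`, then `r` can be created by
exchanging at most `2 * k` of the tuples in `u`. -/
theorem exists_exchange (hk : 0 < k) {u v : InjTuple k →₀ ℕ} {r : InjTuple k}
    (h : countMat u = countMat (Finsupp.single r 1 + v)) :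
    ∃ t w : InjTuple k →₀ ℕ, t ≤ u ∧ t.degree ≤ 2 * k ∧
      countMat t = countMat (Finsupp.single r 1 + w) := by
  classical
  let i₀ : Fin k := ⟨0, hk⟩
  have hdeg : u.degree = 1 + v.degree := by
    rw [← degree_countMat u i₀, h, degree_countMat, map_add, Finsupp.degree_single]
  have hρ : ∀ i, ∃ J ∈ u.support, J.1 i = r.1 i := fun i => by
    refine exists_mem_support_of_countMat_ne_zero ?_
    rw [h]
    exact countMat_apply_ne_zero (by simp) i
  choose ρ hρu hρr using hρ
  have hσ : ∀ i, ∃ J ∈ u.support, (ρ i₀).1 i ∉ Set.range r.1 → (ρ i₀).1 i ∉ Set.range J.1 := by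
    intro i
    by_contra! hcon
    have hr := (hcon (ρ i₀) (hρu i₀)).1
    have h1 := degree_le_sum_countMat fun J hJ => (hcon J hJ).2
    have h2 := sum_countMat_lt (u := Finsupp.single r 1 + v) (by simp) hr
    rw [← h, map_add, Finsupp.degree_single] at h2
    omega
  choose σ hσu hσr using hσ
  let s : Finset (InjTuple k) := Finset.univ.image ρ ∪ Finset.univ.image σ
  let t : InjTuple k →₀ ℕ := Finsupp.indicator s fun _ _ => 1
  have hsu : s ⊆ u.support := by
    intro J hJ
    rcases Finset.mem_union.1 hJ with hJ | hJ <;> obtain ⟨i, -, rfl⟩ := Finset.mem_image.1 hJ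
    exacts [hρu i, hσu i]
  have hst : t.support = s := by
    ext J
    simp [t, Finsupp.indicator_apply]
  have htu : t ≤ u := by
    intro J
    simp only [t, Finsupp.indicator_apply]
    split_ifs with hJ
    · exact Nat.one_le_iff_ne_zero.2 (Finsupp.mem_support_iff.1 (hsu hJ))
    · exact Nat.zero_le _
  have htdeg : t.degree = s.card := by
    rw [Finsupp.degree_apply, hst, Finset.card_eq_sum_ones]
    exact Finset.sum_congr rfl fun J hJ => by simp [t, Finsupp.indicator_apply, hJ]
  have hρs : ∀ i, ρ i ∈ t.support := fun i => by simp [hst, s]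
  have hσs : ∀ i, σ i ∈ t.support := fun i => by simp [hst, s]
  have hcard : s.card ≤ 2 * k := by
    have h1 := Finset.card_union_le (Finset.univ.image ρ) (Finset.univ.image σ)
    have h2 : (Finset.univ.image ρ).card ≤ k := Finset.card_image_le.trans (by simp)
    have h3 : (Finset.univ.image σ).card ≤ k := Finset.card_image_le.trans (by simp)
    exact h1.trans (by omega)
  have hsub : countMat (Finsupp.single r 1) ≤ countMat t := by
    intro i
    rw [countMat_single, Finsupp.single_le_iff, ← hρr i]
    exact Nat.one_le_iff_ne_zero.2 (countMat_apply_ne_zero (hρs i) i)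
  obtain ⟨C, hC⟩ := exists_add_of_le hsub
  obtain ⟨w, rfl⟩ := exists_countMat_eq (t.degree - 1) C (fun i => by
    have := congrArg Finsupp.degree (congrFun hC i)
    rw [Pi.add_apply, map_add, degree_countMat, degree_countMat, Finsupp.degree_single] at this
    omega) (fun j => by
    have hsum : ∑ i, countMat t i j =
        ∑ i, countMat (Finsupp.single r 1) i j + ∑ i, C i j := by
      simp only [hC, Pi.add_apply, Finsupp.add_apply, Finset.sum_add_distrib]
    by_cases hj : j ∈ Set.range r.1
    · have h1 := sum_countMat_le t j
      have h2 := degree_le_sum_countMat (u := Finsupp.single r 1) (j := j) (by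
        intro J hJ
        rw [Finsupp.mem_support_single] at hJ
        rwa [hJ.1])
      rw [Finsupp.degree_single] at h2
      omega
    · obtain ⟨J, hJt, hJ⟩ : ∃ J ∈ t.support, j ∉ Set.range J.1 := by
        by_cases hj₀ : j ∈ Set.range (ρ i₀).1
        · obtain ⟨i, rfl⟩ := hj₀
          exact ⟨σ i, hσs i, hσr i hj⟩
        · exact ⟨ρ i₀, hρs i₀, hj₀⟩
      have := sum_countMat_lt hJt hJ
      omega)
  exact ⟨t, w, htu, htdeg ▸ hcard, by rw [hC, map_add]⟩

/-- The congruence `countMat u = countMat v` is generated in degrees at most `2 * k`. -/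
theorem con_of_countMat_eq (hk : 0 < k) (c : AddCon (InjTuple k →₀ ℕ))
    (hc : ∀ t t' : InjTuple k →₀ ℕ, countMat t = countMat t' → t.degree ≤ 2 * k → c t t')
    {u v : InjTuple k →₀ ℕ} (h : countMat u = countMat v) : c u v := by
  let i₀ : Fin k := ⟨0, hk⟩
  obtain ⟨n, hn⟩ : ∃ n, v.degree = n := ⟨_, rfl⟩
  induction n generalizing u v with
  | zero =>
    refine hc u v h ?_
    rw [← degree_countMat u i₀, h, degree_countMat, hn]
    exact Nat.zero_le _
  | succ n ih =>
    obtain ⟨r, hr⟩ : ∃ r, v r ≠ 0 := by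
      by_contra! h0
      rw [Finsupp.ext (g := 0) h0, map_zero] at hn
      omega
    obtain ⟨v, rfl⟩ := exists_add_of_le (Finsupp.single_le_iff.2 (Nat.one_le_iff_ne_zero.2 hr))
    obtain ⟨t, w, htu, htd, htw⟩ := exists_exchange hk h
    obtain ⟨u, rfl⟩ := exists_add_of_le htu
    have hwu : countMat (w + u) = countMat v := by
      rw [map_add, htw, map_add, map_add, add_assoc] at h
      rw [map_add]
      exact add_left_cancel h
    have h1 : c (t + u) (Finsupp.single r 1 + w + u) := c.add (hc _ _ htw htd) (c.refl u)
    have h2 : c (Finsupp.single r 1 + (w + u)) (Finsupp.single r 1 + v) :=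
      c.add (c.refl _) (ih hwu (by rw [map_add, Finsupp.degree_single] at hn; omega))
    rw [← add_assoc] at h2
    exact c.trans h1 h2

end Exchange

section Standardization

variable {k : ℕ}

theorem exists_strictMono_preimage_lt_card (V : Finset ℕ) :
    ∃ π : ℕ → ℕ, StrictMono π ∧ ∀ x ∈ V, ∃ y < V.card, π y = x := by
  classical
  let p : ℕ → Prop := fun x => x ∈ V ∨ V.sup id < x
  have hinf : (Set.ofPred p).Infinite :=
    (Set.Ioi_infinite (V.sup id)).mono fun x hx => Or.inr hx
  refine ⟨Nat.nth p, Nat.nth_strictMono hinf, fun x hx => ⟨Nat.count p x, ?_, ?_⟩⟩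
  · rw [Nat.count_eq_card_filter_range]
    refine Finset.card_lt_card ⟨fun y hy => ?_, fun h => ?_⟩
    · rw [Finset.mem_filter, Finset.mem_range] at hy
      have hxs : id x ≤ V.sup id := Finset.le_sup hx
      exact hy.2.resolve_right fun h => by simp only [id] at hxs; omega
    · simpa using h hx
  · exact Nat.nth_count (p := p) (Or.inl hx)

theorem finite_setOf_forall_lt (k N : ℕ) : {J : InjTuple k | ∀ i, J.1 i < N}.Finite := by
  have h : {f : Fin k → ℕ | ∀ i, f i ∈ Set.Iio N}.Finite :=
    Set.Finite.pi' fun _ => Set.finite_Iio N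
  exact h.preimage (f := fun J : InjTuple k => J.1) Subtype.val_injective.injOn

theorem card_support_le_degree (v : ℕ →₀ ℕ) : v.support.card ≤ v.degree := by
  rw [Finset.card_eq_sum_ones, Finsupp.degree_apply]
  exact Finset.sum_le_sum fun j hj =>
    Nat.one_le_iff_ne_zero.2 (Finsupp.mem_support_iff.1 hj)

/-- Up to strictly increasing maps, there are only finitely many pairs of multisets of tuples with
equal counts and bounded degree. -/
theorem exists_finite_standard (hk : 0 < k) (D : ℕ) :
    ∃ F : Set (InjTuple k →₀ ℕ), F.Finite ∧
      ∀ t t' : InjTuple k →₀ ℕ, countMat t = countMat t' → t.degree ≤ D →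
        ∃ (π : ℕ → ℕ) (hπ : StrictMono π), ∃ s ∈ F, ∃ s' ∈ F, countMat s = countMat s' ∧
          s.mapDomain (incTuple π hπ) = t ∧ s'.mapDomain (incTuple π hπ) = t' := by
  classical
  let i₀ : Fin k := ⟨0, hk⟩
  let S : Finset (InjTuple k) := (finite_setOf_forall_lt k (k * D)).toFinset
  refine ⟨Set.Iic (Finsupp.indicator S fun _ _ => D), Set.finite_Iic _, fun t t' h hD => ?_⟩
  let V : Finset ℕ := Finset.univ.biUnion fun i => (countMat t i).support
  have hV : V.card ≤ k * D := by
    refine Finset.card_biUnion_le.trans ?_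
    calc ∑ i, (countMat t i).support.card ≤ ∑ _i : Fin k, D :=
          Finset.sum_le_sum fun i _ =>
            (card_support_le_degree _).trans ((degree_countMat t i).trans_le hD)
      _ = k * D := by simp
  obtain ⟨π, hπ, hπV⟩ := exists_strictMono_preimage_lt_card V
  have hg : ∀ J : InjTuple k, ∃ J₀ : InjTuple k, (∀ i, J.1 i ∈ V) →
      J₀ ∈ S ∧ incTuple π hπ J₀ = J := by
    intro J
    by_cases hJ : ∀ i, J.1 i ∈ V
    · choose y hy hyJ using fun i => hπV _ (hJ i)
      refine ⟨⟨y, fun i i' hii => J.2 ?_⟩, fun _ => ⟨?_, ?_⟩⟩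
      · rw [← hyJ, ← hyJ, hii]
      · exact (Set.Finite.mem_toFinset _).2 fun i => (hy i).trans_le hV
      · exact Subtype.ext (funext hyJ)
    · exact ⟨J, fun h => absurd h hJ⟩
  choose g hg using hg
  have key : ∀ u : InjTuple k →₀ ℕ, countMat t = countMat u → u.degree ≤ D →
      u.mapDomain g ∈ Set.Iic (Finsupp.indicator S fun _ _ => D) ∧
        (u.mapDomain g).mapDomain (incTuple π hπ) = u := by
    intro u hu hD
    have huV : ∀ J ∈ u.support, ∀ i, J.1 i ∈ V := fun J hJ i =>
      Finset.mem_biUnion.2 ⟨i, Finset.mem_univ _, Finsupp.mem_support_iff.2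
        (hu ▸ countMat_apply_ne_zero hJ i)⟩
    constructor
    · intro J
      rw [Finsupp.indicator_apply]
      split_ifs with hJ
      · exact (Finsupp.le_degree _ _).trans ((Finsupp.degree_mapDomain g u).trans_le hD)
      · rw [Nat.le_zero, ← Finsupp.notMem_support_iff]
        intro hJg
        obtain ⟨J', hJ', rfl⟩ := Finset.mem_image.1 (Finsupp.mapDomain_support hJg)
        exact hJ (hg J' (huV J' hJ')).1
    · rw [← Finsupp.mapDomain_comp]
      conv_rhs => rw [← Finsupp.mapDomain_id (v := u)]
      exact Finsupp.mapDomain_congr fun J hJ => (hg J (huV J hJ)).2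
  have hD' : t'.degree ≤ D := by
    rwa [← degree_countMat t' i₀, ← h, degree_countMat]
  obtain ⟨h1, h2⟩ := key t rfl hD
  obtain ⟨h1', h2'⟩ := key t' h hD'
  refine ⟨π, hπ, _, h1, _, h1', ?_, h2, h2'⟩
  funext i
  refine Finsupp.mapDomain_injective hπ.injective ?_
  rw [← countMat_mapDomain_incTuple π hπ, ← countMat_mapDomain_incTuple π hπ, h2, h2', h]

end Standardization

section Order

variable {k : ℕ}

/-- The order on matrices comparing the first distinct rows at their last distinct entry. -/
def MatLT (A B : Fin k → ℕ →₀ ℕ) : Prop :=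
  Pi.Lex (· < ·) (fun {_} => Finsupp.Lex (· > ·) (· < ·)) A B

theorem matLT_iff {A B : Fin k → ℕ →₀ ℕ} : MatLT A B ↔
    ∃ i, (∀ i' < i, A i' = B i') ∧ ∃ j, (∀ j' > j, A i j' = B i j') ∧ A i j < B i j :=
  Iff.rfl

theorem wellFounded_matLT : WellFounded (MatLT (k := k)) :=
  Pi.Lex.wellFounded _ fun _ =>
    Finsupp.Lex.wellFounded' (fun _ => Nat.not_lt_zero _) wellFounded_lt wellFounded_lt

theorem eq_or_matLT_or_matLT (A B : Fin k → ℕ →₀ ℕ) : A = B ∨ MatLT A B ∨ MatLT B A := by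
  classical
  by_cases h : A = B
  · exact Or.inl h
  right
  obtain ⟨i, hi, hmin⟩ : ∃ i, A i ≠ B i ∧ ∀ i' < i, A i' = B i' := by
    obtain ⟨i, hi, hmin⟩ := wellFounded_lt.has_min {i | A i ≠ B i} (Function.ne_iff.1 h)
    exact ⟨i, hi, fun i' hi' => by_contra fun hne => hmin i' hne hi'⟩
  have hne : (Finsupp.neLocus (A i) (B i)).Nonempty := by simpa using hi
  have hj := Finset.max'_mem _ hne
  rw [Finsupp.mem_neLocus] at hj
  have hmax : ∀ j' > (Finsupp.neLocus (A i) (B i)).max' hne, A i j' = B i j' := fun j' hj' =>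
    by_contra fun hne' => absurd (Finset.le_max' _ j' (Finsupp.mem_neLocus.2 hne')) (not_le.2 hj')
  rcases lt_or_gt_of_ne hj with hlt | hlt
  · exact Or.inl (matLT_iff.2 ⟨i, hmin, _, hmax, hlt⟩)
  · exact Or.inr (matLT_iff.2 ⟨i, fun i' hi' => (hmin i' hi').symm, _,
      fun j' hj' => (hmax j' hj').symm, hlt⟩)

theorem MatLT.add_right {A B : Fin k → ℕ →₀ ℕ} (h : MatLT A B) (C : Fin k → ℕ →₀ ℕ) :
    MatLT (A + C) (B + C) := by
  obtain ⟨i, hi, j, hj, hlt⟩ := matLT_iff.1 h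
  refine matLT_iff.2 ⟨i, fun i' hi' => ?_, j, fun j' hj' => ?_, ?_⟩
  · simp [hi i' hi']
  · simp [hj j' hj']
  · simpa using hlt

theorem MatLT.mapDomain {u v : InjTuple k →₀ ℕ} (h : MatLT (countMat u) (countMat v))
    {π : ℕ → ℕ} (hπ : StrictMono π) :
    MatLT (countMat (u.mapDomain (incTuple π hπ))) (countMat (v.mapDomain (incTuple π hπ))) := by
  obtain ⟨i, hi, j, hj, hlt⟩ := matLT_iff.1 h
  refine matLT_iff.2 ⟨i, fun i' hi' => ?_, π j, fun j' hj' => ?_, ?_⟩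
  · rw [countMat_mapDomain_incTuple, countMat_mapDomain_incTuple, hi i' hi']
  · rw [countMat_mapDomain_incTuple, countMat_mapDomain_incTuple]
    by_cases hr : j' ∈ Set.range π
    · obtain ⟨l, rfl⟩ := hr
      rw [Finsupp.mapDomain_apply hπ.injective, Finsupp.mapDomain_apply hπ.injective]
      exact hj l (hπ.lt_iff_lt.1 hj')
    · rw [Finsupp.mapDomain_of_notMem_range _ _ hr, Finsupp.mapDomain_of_notMem_range _ _ hr]
  · rwa [countMat_mapDomain_incTuple, countMat_mapDomain_incTuple,
      Finsupp.mapDomain_apply hπ.injective, Finsupp.mapDomain_apply hπ.injective]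

end Order

section WellQuasiOrder

variable {k : ℕ}

/-- Divisibility up to strictly increasing maps in the monoid of matrices `countMat u`. -/
def CountDvd (u v : InjTuple k →₀ ℕ) : Prop :=
  ∃ (π : ℕ → ℕ) (hπ : StrictMono π) (w : InjTuple k →₀ ℕ),
    countMat v = countMat (u.mapDomain (incTuple π hπ) + w)

theorem countDvd_of_strictMono {u v : InjTuple k →₀ ℕ} {π : ℕ → ℕ} (hπ : StrictMono π)
    (hle : ∀ i j, countMat u i j ≤ countMat v i (π j))
    (hrange : ∀ j, ∑ i, countMat v i (π j) + u.degree ≤ v.degree + ∑ i, countMat u i j)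
    (hcompl : ∀ j, j ∉ Set.range π → ∑ i, countMat v i j + u.degree ≤ v.degree) :
    CountDvd u v := by
  have hsub : countMat (u.mapDomain (incTuple π hπ)) ≤ countMat v := by
    intro i j
    rw [countMat_mapDomain_incTuple]
    by_cases hj : j ∈ Set.range π
    · obtain ⟨l, rfl⟩ := hj
      rw [Finsupp.mapDomain_apply hπ.injective]
      exact hle i l
    · rw [Finsupp.mapDomain_of_notMem_range _ _ hj]
      exact Nat.zero_le _
  obtain ⟨C, hC⟩ := exists_add_of_le hsub
  obtain ⟨w, rfl⟩ := exists_countMat_eq (v.degree - u.degree) C (fun i => by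
    have := congrArg Finsupp.degree (congrFun hC i)
    rw [Pi.add_apply, map_add, degree_countMat, degree_countMat, Finsupp.degree_mapDomain] at this
    omega) (fun j => by
    have hsum : ∑ i, countMat v i j =
        ∑ i, countMat (u.mapDomain (incTuple π hπ)) i j + ∑ i, C i j := by
      simp only [hC, Pi.add_apply, Finsupp.add_apply, Finset.sum_add_distrib]
    by_cases hj : j ∈ Set.range π
    · obtain ⟨l, rfl⟩ := hj
      simp only [countMat_mapDomain_incTuple, Finsupp.mapDomain_apply hπ.injective] at hsum
      have := hrange l
      omega
    · have := hcompl j hj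
      omega)
  exact ⟨π, hπ, w, by rw [hC, map_add]⟩

theorem exists_countDvd_of_flags (u : ℕ → InjTuple k →₀ ℕ) (T : ℕ → ℕ → Bool) (K : ℕ)
    (hunflagged : ∀ m n, m < n → ∀ j, T n j = false →
      ∑ i, countMat (u n) i j + (u m).degree ≤ (u n).degree)
    (hcard : ∀ n (s : Finset ℕ), (∀ j ∈ s, T n j = true) → s.card ≤ K)
    (hflagged : ∀ n j, T n j = true → ∑ i, countMat (u n) i j ≠ 0) :
    ∃ m n, m < n ∧ CountDvd (u m) (u n) := by
  classical
  let letter : ℕ → ℕ → (Fin k → ℕ) × ℕ := fun n j => (fun i => countMat (u n) i j,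
    if T n j then (u n).degree - ∑ i, countMat (u n) i j + 1 else 0)
  let L : (Fin k → ℕ) × ℕ → Bool := fun b => decide (b.2 ≠ 0)
  have hL : ∀ n j, L (letter n j) = T n j := by
    intro n j
    cases h : T n j <;> simp [L, letter, h]
  choose N hN using fun n => exists_forall_apply_eq_zero (countMat (u n))
  let word : ℕ → List ((Fin k → ℕ) × ℕ) := fun n => (List.range (N n)).map (letter n)
  have hword : ∀ n j, (word n).getD j (0, 0) = letter n j := by
    intro n j
    by_cases hj : j < N n
    · simp [word, List.getD_eq_getElem?_getD, hj]
    · have h0 : ∀ i, countMat (u n) i j = 0 := fun i => hN n i j (not_lt.1 hj)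
      have hT : T n j = false := by
        by_contra h
        exact hflagged n j (by simpa using h) (Finset.sum_eq_zero fun i _ => h0 i)
      rw [List.getD_eq_default _ _ (by simpa [word] using hj)]
      simp only [letter, h0, hT]
      rfl
  have hcount : ∀ n, word n ∈ {l : List ((Fin k → ℕ) × ℕ) | l.countP L ≤ K} := by
    intro n
    change (word n).countP L ≤ K
    rw [List.countP_map, List.countP_eq_length_filter,
      ← List.toFinset_card_of_nodup (List.nodup_range.filter _)]
    refine hcard n _ fun j hj => ?_
    rw [List.mem_toFinset, List.mem_filter] at hj
    rw [← hL]
    exact hj.2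
  obtain ⟨m, n, hmn, hemb⟩ := (FlaggedEmbedding.partiallyWellOrderedOn L K).exists_lt hcount
  obtain ⟨π, hπ, hrange, hcompl⟩ := hemb.exists_strictMono (0, 0)
  simp only [hword, hL] at hrange hcompl
  refine ⟨m, n, hmn, countDvd_of_strictMono hπ (fun i j => (hrange j).1.1 i) (fun j => ?_)
    fun j hj => hunflagged m n hmn j (hcompl j hj)⟩
  obtain ⟨hle, hT⟩ := hrange j
  cases h : T n (π j)
  · have := hunflagged m n hmn (π j) h
    omega
  · have h2 := hle.2
    simp only [letter, hT, h, if_true] at h2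
    have h3 := sum_countMat_le (u n) (π j)
    have h4 := sum_countMat_le (u m) j
    omega

theorem sum_sum_countMat_le (u : InjTuple k →₀ ℕ) (s : Finset ℕ) :
    ∑ j ∈ s, ∑ i, countMat u i j ≤ k * u.degree := by
  rw [Finset.sum_comm]
  calc ∑ i, ∑ j ∈ s, countMat u i j ≤ ∑ _i : Fin k, u.degree := by
        refine Finset.sum_le_sum fun i _ => ?_
        rw [← degree_countMat u i, Finsupp.degree_apply]
        exact Finset.sum_le_sum_of_ne_zero fun j _ hj => Finsupp.mem_support_iff.2 hj
    _ = k * u.degree := by simp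

/-- Divisibility up to strictly increasing maps is a well-quasi-order. -/
theorem wellQuasiOrdered_countDvd : WellQuasiOrdered (CountDvd (k := k)) := by
  intro u
  obtain ⟨g, hg⟩ := exists_increasing_or_nonincreasing_subseq (fun x y : ℕ => x = y)
    fun n => (u n).degree
  rcases hg with hg | hg
  · obtain ⟨m, n, hmn, h⟩ := exists_countDvd_of_flags (fun n => u (g n))
      (fun n j => decide (∑ i, countMat (u (g n)) i j ≠ 0)) (k * (u (g 0)).degree)
      (fun m n hmn j hj => by
        have h1 := hg m n hmn
        have h2 : ∑ i, countMat (u (g n)) i j = 0 := by simpa using hj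
        rw [h2, zero_add]
        exact h1.le)
      (fun n s hs => by
        have hdeg : (u (g n)).degree = (u (g 0)).degree := by
          rcases n.eq_zero_or_pos with rfl | hn
          · rfl
          · exact (hg 0 n hn).symm
        rw [← hdeg, Finset.card_eq_sum_ones]
        refine le_trans (Finset.sum_le_sum fun j hj => ?_) (sum_sum_countMat_le (u (g n)) s)
        exact Nat.one_le_iff_ne_zero.2 (of_decide_eq_true (hs j hj)))
      (fun n j hj => of_decide_eq_true hj)
    exact ⟨g m, g n, g.lt_iff_lt.2 hmn, h⟩
  · have : IsTrans ℕ fun x y => 2 * x ≤ y := ⟨fun x y z h h' => by omega⟩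
    obtain ⟨f, hf⟩ := exists_increasing_or_nonincreasing_subseq (fun x y : ℕ => 2 * x ≤ y)
      fun n => (u (g n)).degree
    rcases hf with hf | hf
    · obtain ⟨m, n, hmn, h⟩ := exists_countDvd_of_flags (fun n => u (g (f n)))
        (fun n j => decide ((u (g (f n))).degree < 2 * ∑ i, countMat (u (g (f n))) i j)) (2 * k)
        (fun m n hmn j hj => by
          have h1 := hf m n hmn
          have h2 := of_decide_eq_false hj
          omega)
        (fun n s hs => by
          rcases s.eq_empty_or_nonempty with rfl | ⟨j, hj⟩
          · simp
          have hpos : 0 < (u (g (f n))).degree := by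
            have h1 := of_decide_eq_true (hs j hj)
            have h2 := sum_countMat_le (u (g (f n))) j
            omega
          refine Nat.le_of_mul_le_mul_right ?_ hpos
          calc s.card * (u (g (f n))).degree = ∑ _j ∈ s, (u (g (f n))).degree := by simp
            _ ≤ ∑ j ∈ s, 2 * ∑ i, countMat (u (g (f n))) i j :=
              Finset.sum_le_sum fun j hj => (of_decide_eq_true (hs j hj)).le
            _ ≤ 2 * (k * (u (g (f n))).degree) := by
              rw [← Finset.mul_sum]
              exact Nat.mul_le_mul_left 2 (sum_sum_countMat_le _ s)
            _ = 2 * k * (u (g (f n))).degree := (mul_assoc _ _ _).symm)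
        (fun n j hj h => by
          have := of_decide_eq_true hj
          omega)
      exact ⟨g (f m), g (f n), g.lt_iff_lt.2 (f.lt_iff_lt.2 hmn), h⟩
    · exfalso
      have hinj : Function.Injective fun n => (u (g (f (n + 1)))).degree := by
        intro m n hmn
        by_contra hne
        rcases lt_or_gt_of_ne hne with h | h
        · exact hg _ _ (f.lt_iff_lt.2 (Nat.succ_lt_succ h)) hmn
        · exact hg _ _ (f.lt_iff_lt.2 (Nat.succ_lt_succ h)) hmn.symm
      refine Set.infinite_of_injective_forall_mem (s := Set.Iio (2 * (u (g (f 0))).degree))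
        hinj (fun n => ?_) (Set.finite_Iio _)
      exact not_le.1 (hf 0 (n + 1) n.succ_pos)

/-- Every set of multisets of tuples has a finite basis for divisibility. -/
theorem exists_finset_countDvd (S : Set (InjTuple k →₀ ℕ)) :
    ∃ B : Finset (InjTuple k →₀ ℕ), (∀ u ∈ B, u ∈ S) ∧ ∀ v ∈ S, ∃ u ∈ B, CountDvd u v := by
  by_contra! hcon
  obtain ⟨f, -, hf⟩ := exists_seq_of_forall_finset_exists (· ∈ S) (fun u v => ¬ CountDvd u v) hcon
  obtain ⟨m, n, hmn, h⟩ := wellQuasiOrdered_countDvd f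
  exact hf m n hmn h

end WellQuasiOrder

section Kernel

variable {k : ℕ}

/-- The exponent of the monomial to which `tupleMap k a R` sends the monomial with exponent `u`. -/
noncomputable def imageExponent (a : Fin k → ℕ) : (InjTuple k →₀ ℕ) →+ (ℕ →₀ ℕ) :=
  ∑ i, a i • (Pi.evalAddMonoidHom _ i).comp countMat

theorem imageExponent_apply (a : Fin k → ℕ) (u : InjTuple k →₀ ℕ) :
    imageExponent a u = ∑ i, a i • countMat u i := by
  simp [imageExponent]

theorem imageExponent_congr (a : Fin k → ℕ) {u v : InjTuple k →₀ ℕ}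
    (h : countMat u = countMat v) : imageExponent a u = imageExponent a v := by
  rw [imageExponent_apply, imageExponent_apply, h]

theorem imageExponent_mapDomain (a : Fin k → ℕ) (π : ℕ → ℕ) (hπ : StrictMono π)
    (u : InjTuple k →₀ ℕ) :
    imageExponent a (u.mapDomain (incTuple π hπ)) = (imageExponent a u).mapDomain π := by
  simp only [imageExponent_apply, countMat_mapDomain_incTuple, Finsupp.mapDomain_finsetSum,
    Finsupp.mapDomain_smul]

theorem tupleMap_monomial (a : Fin k → ℕ) (R : Type) [CommRing R] (u : InjTuple k →₀ ℕ) (c : R) :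
    tupleMap k a R (monomial u c) = monomial (imageExponent a u) c := by
  have hone : tupleMap k a R (monomial u 1) = monomial (imageExponent a u) 1 := by
    induction u using Finsupp.induction_linear with
    | zero => simp [← MvPolynomial.one_def]
    | add u v hu hv =>
      rw [← one_mul (1 : R), ← monomial_mul, map_mul, hu, hv, monomial_mul, map_add]
    | single J n =>
      rw [← X_pow_eq_monomial, map_pow, tupleMap, aeval_X, imageExponent_apply]
      simp only [countMat_single, X_pow_eq_monomial, Finsupp.smul_single, smul_eq_mul]
      rw [← Finset.prod_pow, monomial_sum_one]
      refine Finset.prod_congr rfl fun i _ => ?_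
      rw [monomial_pow, one_pow, Finsupp.smul_single, smul_eq_mul, mul_comm]
  rw [← mul_one c, ← smul_eq_mul, ← smul_monomial, map_smul, hone, smul_monomial]

/-- The congruence `imageExponent a u = imageExponent a v` is generated by finitely many orbits of
pairs. -/
theorem exists_finite_generating_pairs (hk : 0 < k) (a : Fin k → ℕ) :
    ∃ P : Set ((InjTuple k →₀ ℕ) × (InjTuple k →₀ ℕ)), P.Finite ∧
      (∀ p ∈ P, imageExponent a p.1 = imageExponent a p.2) ∧
      ∀ c : AddCon (InjTuple k →₀ ℕ),
        (∀ p ∈ P, ∀ (π : ℕ → ℕ) (hπ : StrictMono π),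
          c (p.1.mapDomain (incTuple π hπ)) (p.2.mapDomain (incTuple π hπ))) →
        ∀ u v, imageExponent a u = imageExponent a v → c u v := by
  obtain ⟨F, hF, hstd⟩ := exists_finite_standard hk (2 * k)
  let S : Set (InjTuple k →₀ ℕ) :=
    {u | ∃ v, imageExponent a v = imageExponent a u ∧ MatLT (countMat v) (countMat u)}
  obtain ⟨B, hBS, hB⟩ := exists_finset_countDvd S
  have hlow : ∀ u, ∃ v, u ∈ B →
      imageExponent a v = imageExponent a u ∧ MatLT (countMat v) (countMat u) := fun u => by
    by_cases hu : u ∈ B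
    · obtain ⟨v, hv⟩ := hBS u hu
      exact ⟨v, fun _ => hv⟩
    · exact ⟨0, fun h => absurd h hu⟩
  choose low hlow using hlow
  refine ⟨{p ∈ F ×ˢ F | countMat p.1 = countMat p.2} ∪ (fun u => (u, low u)) '' B,
    ((hF.prod hF).subset (Set.sep_subset _ _)).union (B.finite_toSet.image _), ?_, ?_⟩
  · rintro _ (⟨-, h⟩ | ⟨u, hu, rfl⟩)
    · exact imageExponent_congr a h
    · exact (hlow u hu).1.symm
  intro c hc
  have hcount : ∀ {u v : InjTuple k →₀ ℕ}, countMat u = countMat v → c u v := by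
    intro u v huv
    refine con_of_countMat_eq hk c (fun t t' h hdeg => ?_) huv
    obtain ⟨π, hπ, s, hs, s', hs', hss, rfl, rfl⟩ := hstd t t' h hdeg
    exact hc (s, s') (Or.inl ⟨⟨hs, hs'⟩, hss⟩) π hπ
  have hmin : ∀ u, ∃ u', c u u' ∧ imageExponent a u' = imageExponent a u ∧ u' ∉ S := by
    intro u
    induction u using (InvImage.wf countMat wellFounded_matLT).induction with
    | _ u ih =>
      by_cases hu : u ∈ S
      · obtain ⟨u₀, hu₀, π, hπ, w, hw⟩ := hB u hu
        obtain ⟨hexp, hlt⟩ := hlow u₀ hu₀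
        have hcon : c u ((low u₀).mapDomain (incTuple π hπ) + w) :=
          c.trans (hcount hw)
            (c.add (hc (u₀, low u₀) (Or.inr ⟨u₀, hu₀, rfl⟩) π hπ) (c.refl w))
        obtain ⟨u', h1, h2, h3⟩ := ih ((low u₀).mapDomain (incTuple π hπ) + w) (by
          change MatLT _ _
          rw [hw, map_add, map_add]
          exact (hlt.mapDomain hπ).add_right _)
        refine ⟨u', c.trans hcon h1, h2.trans ?_, h3⟩
        rw [imageExponent_congr a hw, map_add, map_add, imageExponent_mapDomain,
          imageExponent_mapDomain, hexp]
      · exact ⟨u, c.refl u, rfl, hu⟩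
  intro u v huv
  obtain ⟨u', hu, hu', huS⟩ := hmin u
  obtain ⟨v', hv, hv', hvS⟩ := hmin v
  refine c.trans hu (c.trans (hcount ?_) (c.symm hv))
  have he : imageExponent a u' = imageExponent a v' := by rw [hu', hv', huv]
  rcases eq_or_matLT_or_matLT (countMat u') (countMat v') with h | h | h
  · exact h
  · exact absurd ⟨u', he, h⟩ hvS
  · exact absurd ⟨v', he.symm, h⟩ huS

/-- The congruence on exponents defined by the binomials in an ideal. -/
noncomputable def binomialCon {σ R : Type*} [CommRing R] (I : Ideal (MvPolynomial σ R)) :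
    AddCon (σ →₀ ℕ) where
  r u v := monomial u (1 : R) - monomial v 1 ∈ I
  iseqv :=
    { refl := fun u => by simp
      symm := fun {u v} h => by simpa using I.neg_mem h
      trans := fun {u v w} h h' => by simpa using I.add_mem h h' }
  add' := fun {u v w x} h h' => by
    have := I.add_mem (I.mul_mem_right (monomial w 1) h) (I.mul_mem_left (monomial v 1) h')
    rw [sub_mul, mul_sub, monomial_mul, monomial_mul, monomial_mul, mul_one] at this
    simpa using this

theorem ker_tupleMap_le (a : Fin k → ℕ) (R : Type) [CommRing R]
    (I : Ideal (MvPolynomial (InjTuple k) R))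
    (h : ∀ u v : InjTuple k →₀ ℕ, imageExponent a u = imageExponent a v → binomialCon I u v) :
    RingHom.ker (tupleMap k a R) ≤ I := by
  classical
  let s : (ℕ →₀ ℕ) → (InjTuple k →₀ ℕ) := Function.invFun (imageExponent a)
  let σ : MvPolynomial ℕ R →ₗ[R] MvPolynomial (InjTuple k) R :=
    (basisMonomials ℕ R).constr R fun n => monomial (s n) 1
  have hσ : ∀ n c, σ (monomial n c) = monomial (s n) c := fun n c => by
    have h1 : σ (monomial n 1) = monomial (s n) 1 := by
      have := (basisMonomials ℕ R).constr_basis R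
        (fun n => (monomial (s n) 1 : MvPolynomial (InjTuple k) R)) n
      rwa [coe_basisMonomials] at this
    rw [← mul_one c, ← smul_eq_mul, ← smul_monomial, map_smul, h1, smul_monomial]
  have key : ∀ p, p - σ (tupleMap k a R p) ∈ I := by
    intro p
    induction p using MvPolynomial.induction_on' with
    | monomial u c =>
      rw [tupleMap_monomial, hσ]
      have hu : imageExponent a u = imageExponent a (s (imageExponent a u)) :=
        (Function.invFun_eq ⟨u, rfl⟩).symm
      have := I.mul_mem_left (C c) (h _ _ hu)
      rwa [mul_sub, C_mul_monomial, C_mul_monomial, mul_one] at this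
    | add p q hp hq =>
      have := I.add_mem hp hq
      rwa [map_add, map_add, add_sub_add_comm]
  intro p hp
  have := key p
  rwa [(RingHom.mem_ker).1 hp, map_zero, sub_zero] at this

end Kernel

/-- Conjecture 5.10 of Aschenbrenner–Hillar, as implied by the Main Theorem: for `k ≥ 1`,
exponents `a₀, …, a_{k-1}` and a Noetherian commutative ring `R`, the kernel of the
monomial map `y_{j₀,…,j_{k-1}} ↦ x_{j₀}^{a₀} ⋯ x_{j_{k-1}}^{a_{k-1}}` (indices distinct)
is generated by the union of finitely many `Inc(ℕ)`-orbits of binomials. -/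
theorem aschenbrenner_hillar_conjecture
    (k : ℕ) (hk : 1 ≤ k) (a : Fin k → ℕ) (R : Type) [CommRing R] [IsNoetherianRing R] :
    ∃ B : Finset (MvPolynomial (InjTuple k) R),
      (∀ b ∈ B, ∃ u v : InjTuple k →₀ ℕ, b = monomial u 1 - monomial v 1) ∧
      RingHom.ker (tupleMap k a R) = Ideal.span
        {g | ∃ b ∈ B, ∃ π : ℕ → ℕ, ∃ hπ : StrictMono π,
          g = rename (incTuple π hπ) b} := by
  obtain ⟨P, hPfin, hPker, hPgen⟩ := exists_finite_generating_pairs hk a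
  let bin : (InjTuple k →₀ ℕ) × (InjTuple k →₀ ℕ) → MvPolynomial (InjTuple k) R :=
    fun p => monomial p.1 1 - monomial p.2 1
  refine ⟨(hPfin.image bin).toFinset, fun b hb => ?_, le_antisymm ?_ ?_⟩
  · obtain ⟨p, -, rfl⟩ := (Set.Finite.mem_toFinset _).1 hb
    exact ⟨p.1, p.2, rfl⟩
  · refine ker_tupleMap_le a R _ (hPgen _ fun p hp π hπ => Ideal.subset_span ?_)
    refine ⟨bin p, (Set.Finite.mem_toFinset _).2 ⟨p, hp, rfl⟩, π, hπ, ?_⟩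
    rw [map_sub, rename_monomial, rename_monomial]
  · rw [Ideal.span_le]
    rintro _ ⟨b, hb, π, hπ, rfl⟩
    obtain ⟨p, hp, rfl⟩ := (Set.Finite.mem_toFinset _).1 hb
    rw [SetLike.mem_coe, RingHom.mem_ker, map_sub, rename_monomial, rename_monomial, map_sub,
      tupleMap_monomial, tupleMap_monomial, imageExponent_mapDomain, imageExponent_mapDomain,
      hPker p hp, sub_self]
end

section
/- Let m ∈ ℕ, let 𝓕 be a finite set of subsets of [m], and let T ⊆ [m] be such that |F ∩ T| ≤ 1 for every F ∈ 𝓕 (T is an independent set for 𝓕). For each t ∈ [m] \ T fix r_t ∈ ℕ. Let A be the set of functions α : [m] → ℕ with α(t) < r_t for all t ∈ [m] \ T, let Y = {y_α : α ∈ A}, and let X = {x_{F,β} : F ∈ 𝓕, β : F → ℕ with β(t) < r_t for all t ∈ F \ T}. Let φ : ℤ[Y] → ℤ[X] be the ring homomorphism with φ(y_α) = ∏_{F ∈ 𝓕} x_{F, α|_F}, where α|_F is the restriction of α to F. Let Sym(ℕ) act on A by (σ·α)(t) = σ(α(t)) for t ∈ T and (σ·α)(t) = α(t) for t ∉ T,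 hence on the variables Y; let Sym(ℕ) act on X by replacing β(t₀) by σ(β(t₀)) for the unique element t₀ of F ∩ T when F ∩ T ≠ ∅, and trivially on x_{F,β} when F ∩ T = ∅. Then φ is Sym(ℕ)-equivariant, and ker φ is generated as an ideal of ℤ[Y] by the union of finitely many Sym(ℕ)-orbits of binomials (differences of two monomials in the variables y_α). -/
open MvPolynomial

variable (m : ℕ) (T : Finset (Fin m)) (r : Fin m → ℕ)

/-- The index set `A` of the variables `y_α`: functions `α : [m] → ℕ` with `α t < r t`
for all `t ∈ [m] \ T`. -/
def IndepY : Type := {α : Fin m → ℕ // ∀ t, t ∉ T → α t < r t}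

/-- The index set of the variables `x_{F,β}`: pairs of a set `F ∈ 𝓕` and a function
`β : F → ℕ` with `β t < r t` for all `t ∈ F \ T`. -/
def IndepX (𝓕 : Finset (Finset (Fin m))) : Type :=
  Σ F : {F : Finset (Fin m) // F ∈ 𝓕},
    {β : {t : Fin m // t ∈ F.1} → ℕ // ∀ t, t.1 ∉ T → β t < r t.1}

/-- The action of `Sym(ℕ)` on the index set of `Y`: `(σ·α)(t) = σ(α t)` for `t ∈ T` and
`(σ·α)(t) = α t` otherwise. -/
def actY (σ : Equiv.Perm ℕ) (α : IndepY m T r) : IndepY m T r :=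
  ⟨fun t => if t ∈ T then σ (α.1 t) else α.1 t, fun t ht => by
    beta_reduce; rw [if_neg ht]; exact α.2 t ht⟩

/-- The action of `Sym(ℕ)` on the index set of `X`: `β(t₀)` is replaced by `σ(β t₀)` for
the (at most one) element `t₀` of `F ∩ T`, and nothing changes when `F ∩ T = ∅`. -/
def actX (𝓕 : Finset (Finset (Fin m))) (σ : Equiv.Perm ℕ) (x : IndepX m T r 𝓕) :
    IndepX m T r 𝓕 :=
  ⟨x.1, ⟨fun t => if t.1 ∈ T then σ (x.2.1 t) else x.2.1 t, fun t ht => by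
    beta_reduce; rw [if_neg ht]; exact x.2.2 t ht⟩⟩

/-- The monomial map `φ : ℤ[Y] → ℤ[X]`, `y_α ↦ ∏_{F ∈ 𝓕} x_{F, α|_F}`. -/
noncomputable def indepPhi (𝓕 : Finset (Finset (Fin m))) :
    MvPolynomial (IndepY m T r) ℤ →ₐ[ℤ] MvPolynomial (IndepX m T r 𝓕) ℤ :=
  aeval fun α : IndepY m T r =>
    ∏ F : {F : Finset (Fin m) // F ∈ 𝓕},
      (X (⟨F, ⟨fun t => α.1 t.1, fun t ht => α.2 t.1 ht⟩⟩ : IndepX m T r 𝓕) :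
        MvPolynomial (IndepX m T r 𝓕) ℤ)

section

variable {m : ℕ} {T : Finset (Fin m)} {r : Fin m → ℕ}

namespace IndepY

theorem ext_val {α β : IndepY m T r} (h : ∀ t, α.1 t = β.1 t) : α = β :=
  Subtype.ext (funext h)

/-- The restriction of `α` to the complement of `T`. -/
def rest (α : IndepY m T r) : (t : {t : Fin m // t ∉ T}) → Fin (r t) :=
  fun t => ⟨α.1 t, α.2 t t.2⟩

theorem eq_of_rest_eq {α β : IndepY m T r} (h : α.rest = β.rest) {t : Fin m} (ht : t ∉ T) :
    α.1 t = β.1 t :=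
  congrArg Fin.val (congrFun h ⟨t, ht⟩)

/-- Replace the value of `α` at `t ∈ T` by `n`. -/
def set (α : IndepY m T r) (t : Fin m) (ht : t ∈ T) (n : ℕ) : IndepY m T r :=
  ⟨Function.update α.1 t n, fun s hs => by
    rw [Function.update_of_ne (ne_of_mem_of_not_mem ht hs).symm]; exact α.2 s hs⟩

@[simp]
theorem set_val_self (α : IndepY m T r) (t : Fin m) (ht : t ∈ T) (n : ℕ) :
    (α.set t ht n).1 t = n :=
  Function.update_self ..

theorem set_val_of_ne (α : IndepY m T r) {s t : Fin m} (ht : t ∈ T) (n : ℕ) (h : s ≠ t) :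
    (α.set t ht n).1 s = α.1 s :=
  Function.update_of_ne h ..

@[simp]
theorem rest_set (α : IndepY m T r) (t : Fin m) (ht : t ∈ T) (n : ℕ) :
    (α.set t ht n).rest = α.rest :=
  funext fun s => Fin.ext (α.set_val_of_ne ht n (ne_of_mem_of_not_mem ht s.2).symm)

end IndepY

theorem actY_val_of_mem (σ : Equiv.Perm ℕ) (α : IndepY m T r) {t : Fin m} (ht : t ∈ T) :
    (actY m T r σ α).1 t = σ (α.1 t) :=
  if_pos ht

theorem actY_val_of_notMem (σ : Equiv.Perm ℕ) (α : IndepY m T r) {t : Fin m} (ht : t ∉ T) :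
    (actY m T r σ α).1 t = α.1 t :=
  if_neg ht

@[simp]
theorem rest_actY (σ : Equiv.Perm ℕ) (α : IndepY m T r) : (actY m T r σ α).rest = α.rest :=
  funext fun s => Fin.ext (actY_val_of_notMem σ α s.2)

theorem actY_set (σ : Equiv.Perm ℕ) (α : IndepY m T r) (t : Fin m) (ht : t ∈ T) (n : ℕ) :
    actY m T r σ (α.set t ht n) = (actY m T r σ α).set t ht (σ n) := by
  refine IndepY.ext_val fun s => ?_
  by_cases hst : s = t
  · subst hst
    rw [actY_val_of_mem _ _ ht, IndepY.set_val_self, IndepY.set_val_self]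
  · rw [IndepY.set_val_of_ne _ _ _ hst]
    by_cases hs : s ∈ T
    · rw [actY_val_of_mem _ _ hs, actY_val_of_mem _ _ hs, IndepY.set_val_of_ne _ _ _ hst]
    · rw [actY_val_of_notMem _ _ hs, actY_val_of_notMem _ _ hs, IndepY.set_val_of_ne _ _ _ hst]

theorem actY_symm_actY (σ : Equiv.Perm ℕ) (α : IndepY m T r) :
    actY m T r σ.symm (actY m T r σ α) = α := by
  refine IndepY.ext_val fun s => ?_
  by_cases hs : s ∈ T
  · rw [actY_val_of_mem _ _ hs, actY_val_of_mem _ _ hs, Equiv.symm_apply_apply]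
  · rw [actY_val_of_notMem _ _ hs, actY_val_of_notMem _ _ hs]

/-- The number of factors of a monomial having a given restriction to the complement of `T`. -/
noncomputable def restCount :
    (IndepY m T r →₀ ℕ) →+ (((t : {t : Fin m // t ∉ T}) → Fin (r t)) →₀ ℕ) :=
  Finsupp.mapDomain.addMonoidHom IndepY.rest

/-- The number of factors of a monomial having a given value at `t` and a given restriction to
the complement of `T`. -/
noncomputable def valueCount (t : Fin m) :
    (IndepY m T r →₀ ℕ) →+ ((ℕ × ((t : {t : Fin m // t ∉ T}) → Fin (r t))) →₀ ℕ) :=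
  Finsupp.mapDomain.addMonoidHom fun α => (α.1 t, α.rest)

/-- The quadratic moves exchanging the values at some `t ∈ T` of two indices that agree outside
of `T`. -/
inductive SwapRel : (IndepY m T r →₀ ℕ) → (IndepY m T r →₀ ℕ) → Prop
  | swap (α β : IndepY m T r) (t : Fin m) (ht : t ∈ T) (h : α.rest = β.rest) :
    SwapRel (Finsupp.single α 1 + Finsupp.single β 1)
      (Finsupp.single (α.set t ht (β.1 t)) 1 + Finsupp.single (β.set t ht (α.1 t)) 1)

/-- The additive congruence on exponent vectors generated by the quadratic moves. -/
noncomputable def swapCon (m : ℕ) (T : Finset (Fin m)) (r : Fin m → ℕ) : AddCon (IndepY m T r →₀ ℕ) :=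
  addConGen SwapRel

theorem map_eq_of_swapCon {M : Type*} [AddZeroClass M] (f : (IndepY m T r →₀ ℕ) →+ M)
    (hf : ∀ u v, SwapRel u v → f u = f v) {u v : IndepY m T r →₀ ℕ} (h : swapCon m T r u v) :
    f u = f v :=
  (AddCon.addConGen_le (c := AddCon.ker f)).2 hf h

theorem restCount_eq_of_swapCon {u v : IndepY m T r →₀ ℕ} (h : swapCon m T r u v) :
    restCount u = restCount v := by
  refine map_eq_of_swapCon _ ?_ h
  rintro _ _ ⟨α, β, t, ht, h⟩
  simp [restCount, Finsupp.mapDomain_add, Finsupp.mapDomain_single]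

theorem degree_eq_of_swapCon {u v : IndepY m T r →₀ ℕ} (h : swapCon m T r u v) :
    u.degree = v.degree := by
  refine map_eq_of_swapCon Finsupp.degree ?_ h
  rintro _ _ ⟨α, β, t, ht, h⟩
  simp

theorem valueCount_eq_of_swapCon {u v : IndepY m T r →₀ ℕ} (h : swapCon m T r u v) (s : Fin m) :
    valueCount s u = valueCount s v := by
  refine map_eq_of_swapCon _ ?_ h
  rintro _ _ ⟨α, β, t, ht, h⟩
  simp only [valueCount, Finsupp.mapDomain.addMonoidHom_apply, Finsupp.mapDomain_add,
    Finsupp.mapDomain_single, IndepY.rest_set]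
  by_cases hst : s = t
  · subst hst
    rw [IndepY.set_val_self, IndepY.set_val_self, h, add_comm]
  · rw [IndepY.set_val_of_ne _ _ _ hst, IndepY.set_val_of_ne _ _ _ hst]

/-- Comparison of all the counts attached to two monomials. -/
def CountLE (w u : IndepY m T r →₀ ℕ) : Prop :=
  restCount w ≤ restCount u ∧ ∀ t ∈ T, valueCount t w ≤ valueCount t u

theorem exists_eq_single_add_of_mapDomain_ne_zero {A B : Type*} (f : A → B) (u : A →₀ ℕ) (b : B)
    (h : u.mapDomain f b ≠ 0) : ∃ a c, f a = b ∧ u = Finsupp.single a 1 + c := by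
  classical
  obtain ⟨a, ha, rfl⟩ := Finset.mem_image.1
    (Finsupp.mapDomain_support (Finsupp.mem_support_iff.2 h))
  refine ⟨a, u - Finsupp.single a 1, rfl, (add_tsub_cancel_of_le ?_).symm⟩
  rw [Finsupp.single_le_iff]
  exact Nat.one_le_iff_ne_zero.2 (Finsupp.mem_support_iff.1 ha)

theorem exists_swapCon_single_add (α : IndepY m T r) (u : IndepY m T r →₀ ℕ)
    (h : CountLE (Finsupp.single α 1) u) :
    ∃ c, swapCon m T r u (Finsupp.single α 1 + c) := by
  obtain ⟨hN, hV⟩ := h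
  suffices H : ∀ S ⊆ T, ∃ β c, swapCon m T r u (Finsupp.single β 1 + c) ∧ β.rest = α.rest ∧
      ∀ t ∈ S, β.1 t = α.1 t by
    obtain ⟨β, c, hc, hr, hv⟩ := H T subset_rfl
    have : β = α := IndepY.ext_val fun t => by
      by_cases ht : t ∈ T
      · exact hv t ht
      · exact IndepY.eq_of_rest_eq hr ht
    exact ⟨c, this ▸ hc⟩
  intro S
  induction S using Finset.induction_on with
  | empty =>
    intro _
    have h1 : u.mapDomain IndepY.rest α.rest ≠ 0 := by
      have := hN α.rest
      simp only [restCount, Finsupp.mapDomain.addMonoidHom_apply, Finsupp.mapDomain_single,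
        Finsupp.single_eq_same] at this
      omega
    obtain ⟨β, c, hβ, rfl⟩ := exists_eq_single_add_of_mapDomain_ne_zero _ _ _ h1
    exact ⟨β, c, AddCon.refl _ _, hβ, by simp⟩
  | insert t S _ ih =>
    intro hS
    have ht : t ∈ T := hS (Finset.mem_insert_self ..)
    obtain ⟨β, c, hc, hr, hv⟩ := ih ((Finset.subset_insert ..).trans hS)
    by_cases hβ : β.1 t = α.1 t
    · refine ⟨β, c, hc, hr, fun s hs => ?_⟩
      rcases Finset.mem_insert.1 hs with rfl | hs
      exacts [hβ, hv s hs]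
    have h1 : c.mapDomain (fun α => (α.1 t, α.rest)) (α.1 t, α.rest) ≠ 0 := by
      have := hV t ht (α.1 t, α.rest)
      rw [valueCount_eq_of_swapCon hc] at this
      simp only [valueCount, Finsupp.mapDomain.addMonoidHom_apply, Finsupp.mapDomain_single,
        Finsupp.mapDomain_add, Finsupp.single_eq_same, Finsupp.add_apply] at this
      rw [Finsupp.single_eq_of_ne (by simp [Ne.symm hβ])] at this
      omega
    obtain ⟨γ, d, hγ, rfl⟩ := exists_eq_single_add_of_mapDomain_ne_zero _ _ _ h1
    obtain ⟨hγt, hγr⟩ := Prod.mk.inj hγ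
    refine ⟨β.set t ht (γ.1 t), Finsupp.single (γ.set t ht (β.1 t)) 1 + d, ?_, by simpa, ?_⟩
    · refine hc.trans ?_
      rw [← add_assoc, ← add_assoc]
      exact (swapCon m T r).add (AddConGen.Rel.of _ _ (.swap β γ t ht (hr.trans hγr.symm)))
        (AddCon.refl _ _)
    · intro s hs
      by_cases hst : s = t
      · subst hst
        rw [IndepY.set_val_self, hγt]
      · rw [IndepY.set_val_of_ne _ _ _ hst]
        exact hv s ((Finset.mem_insert.1 hs).resolve_left hst)

theorem CountLE.exists_swapCon_add {w u : IndepY m T r →₀ ℕ} (h : CountLE w u) :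
    ∃ c, swapCon m T r u (w + c) := by
  have hadd : ∀ w₁ w₂ : IndepY m T r →₀ ℕ,
      (∀ u, CountLE w₁ u → ∃ c, swapCon m T r u (w₁ + c)) →
      (∀ u, CountLE w₂ u → ∃ c, swapCon m T r u (w₂ + c)) →
      ∀ u, CountLE (w₁ + w₂) u → ∃ c, swapCon m T r u (w₁ + w₂ + c) := by
    intro w₁ w₂ h₁ h₂ u h
    simp only [CountLE, map_add] at h
    obtain ⟨c, hc⟩ := h₁ u ⟨le_self_add.trans h.1, fun t ht => le_self_add.trans (h.2 t ht)⟩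
    rw [restCount_eq_of_swapCon hc, map_add] at h
    obtain ⟨d, hd⟩ := h₂ c ⟨le_of_add_le_add_left h.1, fun t ht => by
      have := h.2 t ht
      rw [valueCount_eq_of_swapCon hc, map_add] at this
      exact le_of_add_le_add_left this⟩
    refine ⟨d, hc.trans ?_⟩
    rw [add_assoc]
    exact (swapCon m T r).add (AddCon.refl _ _) hd
  have hzero : ∀ u, CountLE (0 : IndepY m T r →₀ ℕ) u → ∃ c, swapCon m T r u (0 + c) :=
    fun u _ => ⟨u, by rw [zero_add]; exact AddCon.refl _ _⟩
  induction w using Finsupp.induction_linear generalizing u with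
  | zero => exact hzero u h
  | add w₁ w₂ h₁ h₂ => exact hadd w₁ w₂ (fun _ => h₁) (fun _ => h₂) u h
  | single α n =>
    induction n generalizing u with
    | zero => simpa using hzero u (by simpa using h)
    | succ n ih =>
      rw [Finsupp.single_add] at h ⊢
      exact hadd _ _ (fun _ => ih) (exists_swapCon_single_add α) u h

theorem restCount_mapDomain_actY (σ : Equiv.Perm ℕ) (u : IndepY m T r →₀ ℕ) :
    restCount (u.mapDomain (actY m T r σ)) = restCount u := by
  simp only [restCount, Finsupp.mapDomain.addMonoidHom_apply, ← Finsupp.mapDomain_comp]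
  congr 1
  exact funext fun α => rest_actY σ α

theorem valueCount_mapDomain_actY (σ : Equiv.Perm ℕ) (u : IndepY m T r →₀ ℕ) {t : Fin m}
    (ht : t ∈ T) (i : ℕ) (a : (t : {t : Fin m // t ∉ T}) → Fin (r t)) :
    valueCount t (u.mapDomain (actY m T r σ)) (σ i, a) = valueCount t u (i, a) := by
  have : valueCount t (u.mapDomain (actY m T r σ)) =
      (valueCount t u).mapDomain (Prod.map σ id) := by
    simp only [valueCount, Finsupp.mapDomain.addMonoidHom_apply, ← Finsupp.mapDomain_comp]
    congr 1
    exact funext fun α => Prod.ext (actY_val_of_mem σ α ht) (rest_actY σ α)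
  rw [this]
  exact Finsupp.mapDomain_apply (σ.injective.prodMap Function.injective_id) _ (i, a)

theorem valueCount_eq_zero {u : IndepY m T r →₀ ℕ} {n : ℕ} (hn : ∀ α ∈ u.support, ∀ t, α.1 t < n)
    (t : Fin m) {i : ℕ} (hi : n ≤ i) (a : (t : {t : Fin m // t ∉ T}) → Fin (r t)) :
    valueCount t u (i, a) = 0 := by
  by_contra h
  obtain ⟨α, c, hα, rfl⟩ := exists_eq_single_add_of_mapDomain_ne_zero _ _ _ h
  have := hn α (by simp) t
  rw [(Prod.mk.inj hα).1] at this
  omega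

theorem exists_val_lt (u : IndepY m T r →₀ ℕ) : ∃ n, ∀ α ∈ u.support, ∀ t, α.1 t < n := by
  refine ⟨(u.support.sup fun α => Finset.univ.sup α.1) + 1, fun α hα t => Nat.lt_succ_of_le ?_⟩
  exact (Finset.le_sup (f := α.1) (Finset.mem_univ t)).trans
    (Finset.le_sup (f := fun α : IndepY m T r => Finset.univ.sup α.1) hα)

/-- The pair `p` divides the pair `q` up to the action of `Sym(ℕ)` and the quadratic moves. -/
def PairLE (p q : (IndepY m T r →₀ ℕ) × (IndepY m T r →₀ ℕ)) : Prop :=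
  ∃ σ : Equiv.Perm ℕ, CountLE (p.1.mapDomain (actY m T r σ)) q.1 ∧
    CountLE (p.2.mapDomain (actY m T r σ)) q.2

theorem wellQuasiOrdered_pairLE : WellQuasiOrdered (PairLE (m := m) (T := T) (r := r)) := by
  have hb : ∀ p : (IndepY m T r →₀ ℕ) × (IndepY m T r →₀ ℕ), ∃ n,
      (∀ α ∈ p.1.support, ∀ t, α.1 t < n) ∧ ∀ α ∈ p.2.support, ∀ t, α.1 t < n := by
    intro p
    obtain ⟨n₁, h₁⟩ := exists_val_lt p.1
    obtain ⟨n₂, h₂⟩ := exists_val_lt p.2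
    exact ⟨max n₁ n₂, fun α hα t => (h₁ α hα t).trans_le (le_max_left ..),
      fun α hα t => (h₂ α hα t).trans_le (le_max_right ..)⟩
  choose n hn₁ hn₂ using hb
  let E := Fin m → ((t : {t : Fin m // t ∉ T}) → Fin (r t)) → ℕ × ℕ
  let entry : (IndepY m T r →₀ ℕ) × (IndepY m T r →₀ ℕ) → ℕ → E :=
    fun p i t a => (valueCount t p.1 (i, a), valueCount t p.2 (i, a))
  have hE : WellQuasiOrdered (List.SublistForall₂ ((· ≤ ·) : E → E → Prop)) := by
    rw [← Set.partiallyWellOrderedOn_univ_iff]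
    refine (Set.PartiallyWellOrderedOn.partiallyWellOrderedOn_sublistForall₂ (s := Set.univ) _
      ?_).mono fun l _ x _ => Set.mem_univ x
    rw [Set.partiallyWellOrderedOn_univ_iff]
    exact wellQuasiOrdered_le
  have hprod := (wellQuasiOrdered_le (α := (((t : {t : Fin m // t ∉ T}) → Fin (r t)) →₀ ℕ) ×
    (((t : {t : Fin m // t ∉ T}) → Fin (r t)) →₀ ℕ))).prod hE
  intro p
  obtain ⟨i, j, hij, hN, hL⟩ := hprod fun k =>
    ((restCount (p k).1, restCount (p k).2), (List.range (n (p k))).map (entry (p k)))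
  refine ⟨i, j, hij, ?_⟩
  obtain ⟨l, hl, hsub⟩ := List.sublistForall₂_iff.1 hL
  obtain ⟨f, hf⟩ := List.sublist_iff_exists_orderEmbedding_getElem?_eq.1 hsub
  obtain ⟨hlen, hl⟩ := List.forall₂_iff_get.1 hl
  have key : ∀ k < n (p i), entry (p i) k ≤ entry (p j) (f k) := by
    intro k hk
    have hk' : k < l.length := by rw [← hlen]; simpa using hk
    have h1 := hl k (by simpa using hk) hk'
    have h2 := hf k
    rw [List.getElem?_eq_getElem hk', eq_comm, List.getElem?_eq_some_iff] at h2
    obtain ⟨h3, h2⟩ := h2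
    simp only [List.get_eq_getElem, List.getElem_map, List.getElem_range] at h1 h2
    rwa [← h2] at h1
  obtain ⟨σ, hσ⟩ := Equiv.Perm.exists_extending_pair
    ((↑) : Fin (n (p i)) → ℕ) (fun k => f k) Fin.val_injective (f.injective.comp Fin.val_injective)
  refine ⟨σ, ⟨?_, fun t ht => ?_⟩, ⟨?_, fun t ht => ?_⟩⟩
  · rw [restCount_mapDomain_actY]
    exact hN.1
  · rintro ⟨k, a⟩
    obtain ⟨k, rfl⟩ := σ.surjective k
    rw [valueCount_mapDomain_actY σ _ ht]
    by_cases hk : k < n (p i)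
    · rw [show σ k = f k from hσ ⟨k, hk⟩]
      exact (key k hk t a).1
    · rw [valueCount_eq_zero (hn₁ (p i)) t (not_lt.1 hk)]
      exact Nat.zero_le _
  · rw [restCount_mapDomain_actY]
    exact hN.2
  · rintro ⟨k, a⟩
    obtain ⟨k, rfl⟩ := σ.surjective k
    rw [valueCount_mapDomain_actY σ _ ht]
    by_cases hk : k < n (p i)
    · rw [show σ k = f k from hσ ⟨k, hk⟩]
      exact (key k hk t a).2
    · rw [valueCount_eq_zero (hn₂ (p i)) t (not_lt.1 hk)]
      exact Nat.zero_le _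

theorem WellQuasiOrdered.exists_finset_basis {A : Type*} {R : A → A → Prop}
    (hR : WellQuasiOrdered R) (P : A → Prop) :
    ∃ G : Finset A, (∀ g ∈ G, P g) ∧ ∀ a, P a → ∃ g ∈ G, R g a := by
  by_contra! H
  obtain ⟨f, -, hf⟩ := exists_seq_of_forall_finset_exists P (fun x y => ¬ R x y) H
  obtain ⟨i, j, hij, h⟩ := hR f
  exact hf i j hij h

variable {𝓕 : Finset (Finset (Fin m))}

/-- The index `(F, α|_F)` of the factor of `φ(y_α)` belonging to `F`. -/
def IndepY.restrict (F : {F : Finset (Fin m) // F ∈ 𝓕}) (α : IndepY m T r) : IndepX m T r 𝓕 :=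
  ⟨F, ⟨fun t => α.1 t.1, fun t ht => α.2 t.1 ht⟩⟩

theorem IndepY.restrict_congr (F : {F : Finset (Fin m) // F ∈ 𝓕}) {α β : IndepY m T r}
    (h : ∀ t ∈ F.1, α.1 t = β.1 t) : α.restrict F = β.restrict F := by
  unfold restrict
  congr 2
  exact funext fun t => h t.1 t.2

theorem indepPhi_X (α : IndepY m T r) :
    indepPhi m T r 𝓕 (X α) = ∏ F : {F : Finset (Fin m) // F ∈ 𝓕}, X (α.restrict F) :=
  aeval_X ..

/-- The map `φ` on exponent vectors. -/
noncomputable def indepExponent (𝓕 : Finset (Finset (Fin m))) :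
    (IndepY m T r →₀ ℕ) →+ (IndepX m T r 𝓕 →₀ ℕ) :=
  ∑ F : {F : Finset (Fin m) // F ∈ 𝓕}, Finsupp.mapDomain.addMonoidHom (IndepY.restrict F)

theorem indepPhi_monomial (u : IndepY m T r →₀ ℕ) (c : ℤ) :
    indepPhi m T r 𝓕 (monomial u c) = monomial (indepExponent 𝓕 u) c := by
  suffices H : indepPhi m T r 𝓕 (monomial u 1) = monomial (indepExponent 𝓕 u) 1 by
    have h1 : (monomial u c : MvPolynomial (IndepY m T r) ℤ) = c • monomial u 1 := by
      rw [smul_monomial, smul_eq_mul, mul_one]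
    rw [h1, map_smul, H, smul_monomial, smul_eq_mul, mul_one]
  induction u using Finsupp.induction_linear with
  | zero => simp
  | add u v hu hv =>
    rw [map_add, ← mul_one (1 : ℤ), ← monomial_mul, map_mul, hu, hv, monomial_mul]
  | single α n =>
    rw [← X_pow_eq_monomial, map_pow, indepPhi_X, indepExponent, AddMonoidHom.finsetSum_apply,
      ← Finset.prod_pow, monomial_sum_one]
    refine Finset.prod_congr rfl fun F _ => ?_
    rw [Finsupp.mapDomain.addMonoidHom_apply, Finsupp.mapDomain_single, X_pow_eq_monomial]

theorem indepExponent_eq_of_swapCon (hT : ∀ F ∈ 𝓕, (F ∩ T).card ≤ 1) {u v : IndepY m T r →₀ ℕ}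
    (h : swapCon m T r u v) : indepExponent 𝓕 u = indepExponent 𝓕 v := by
  refine map_eq_of_swapCon _ ?_ h
  rintro _ _ ⟨α, β, t, ht, h⟩
  simp only [indepExponent, AddMonoidHom.finsetSum_apply]
  refine Finset.sum_congr rfl fun F _ => ?_
  simp only [Finsupp.mapDomain.addMonoidHom_apply, Finsupp.mapDomain_add,
    Finsupp.mapDomain_single]
  by_cases htF : t ∈ F.1
  · have hset : ∀ γ δ : IndepY m T r, γ.rest = δ.rest →
        (γ.set t ht (δ.1 t)).restrict F = δ.restrict F := by
      refine fun γ δ hγδ => IndepY.restrict_congr F fun s hs => ?_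
      by_cases hst : s = t
      · rw [hst, IndepY.set_val_self]
      · rw [IndepY.set_val_of_ne _ _ _ hst]
        refine IndepY.eq_of_rest_eq hγδ fun hsT => hst ?_
        exact Finset.card_le_one.1 (hT F.1 F.2) s (Finset.mem_inter.2 ⟨hs, hsT⟩) t
          (Finset.mem_inter.2 ⟨htF, ht⟩)
    rw [hset α β h, hset β α h.symm, add_comm]
  · have hset : ∀ (γ : IndepY m T r) (n : ℕ), (γ.set t ht n).restrict F = γ.restrict F :=
      fun γ n => IndepY.restrict_congr F fun s hs =>
        γ.set_val_of_ne ht n (ne_of_mem_of_not_mem hs htF)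
    rw [hset, hset]

theorem indepPhi_rename (σ : Equiv.Perm ℕ) (f : MvPolynomial (IndepY m T r) ℤ) :
    indepPhi m T r 𝓕 (rename (actY m T r σ) f) =
      rename (actX m T r 𝓕 σ) (indepPhi m T r 𝓕 f) := by
  refine DFunLike.congr_fun (f := (indepPhi m T r 𝓕).comp (rename (actY m T r σ)))
    (g := (rename (actX m T r 𝓕 σ)).comp (indepPhi m T r 𝓕)) ?_ f
  refine algHom_ext fun α => ?_
  simp only [AlgHom.comp_apply, rename_X, indepPhi_X, map_prod]
  rfl

/-- Two exponent vectors are congruent modulo `I` if the difference of the monomials is in `I`. -/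
def monomialCon {τ : Type*} (I : Ideal (MvPolynomial τ ℤ)) : AddCon (τ →₀ ℕ) where
  r u v := (monomial u 1 - monomial v 1 : MvPolynomial τ ℤ) ∈ I
  iseqv := {
    refl u := by simp
    symm h := by simpa using I.neg_mem h
    trans h₁ h₂ := by simpa using I.add_mem h₁ h₂ }
  add' {u v w x} h₁ h₂ := by
    have := I.add_mem (I.mul_mem_right (monomial w 1) h₁) (I.mul_mem_left (monomial v 1) h₂)
    simpa [sub_mul, mul_sub, monomial_mul] using this

theorem monomialCon_iff {τ : Type*} {I : Ideal (MvPolynomial τ ℤ)} {u v : τ →₀ ℕ} :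
    monomialCon I u v ↔ (monomial u 1 - monomial v 1 : MvPolynomial τ ℤ) ∈ I :=
  Iff.rfl

theorem ker_indepPhi_le {I : Ideal (MvPolynomial (IndepY m T r) ℤ)}
    (hI : ∀ u v, indepExponent 𝓕 u = indepExponent 𝓕 v → monomialCon I u v) :
    RingHom.ker (indepPhi m T r 𝓕) ≤ I := by
  let s := Function.invFun (indepExponent (T := T) (r := r) 𝓕)
  let L := (basisMonomials (IndepX m T r 𝓕) ℤ).constr ℤ fun w =>
    (monomial (s w) 1 : MvPolynomial (IndepY m T r) ℤ)
  have hL : ∀ w, L (monomial w 1) = monomial (s w) 1 := fun w => by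
    have := (basisMonomials (IndepX m T r 𝓕) ℤ).constr_basis ℤ
      (fun w => (monomial (s w) 1 : MvPolynomial (IndepY m T r) ℤ)) w
    rwa [coe_basisMonomials] at this
  have key : ∀ f, f - L (indepPhi m T r 𝓕 f) ∈ I := by
    intro f
    induction f using MvPolynomial.induction_on' with
    | monomial u c =>
      have h1 : (monomial u c : MvPolynomial (IndepY m T r) ℤ) = c • monomial u 1 := by
        rw [smul_monomial, smul_eq_mul, mul_one]
      rw [h1, map_smul, map_smul, indepPhi_monomial, hL, ← smul_sub]
      refine Submodule.smul_of_tower_mem I c (hI _ _ ?_)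
      exact (Function.invFun_eq ⟨u, rfl⟩).symm
    | add p q hp hq =>
      rw [map_add, map_add, add_sub_add_comm]
      exact I.add_mem hp hq
  intro f hf
  have := key f
  rwa [RingHom.mem_ker.1 hf, map_zero, sub_zero] at this

theorem exists_perm_lt_card (s : Finset ℕ) : ∃ σ : Equiv.Perm ℕ, ∀ x ∈ s, σ x < s.card := by
  obtain ⟨σ, hσ⟩ := Equiv.Perm.exists_extending_pair (Subtype.val : s → ℕ)
    (fun x => (s.equivFin x : ℕ)) Subtype.val_injective
    (Fin.val_injective.comp s.equivFin.injective)
  exact ⟨σ, fun x hx => (hσ ⟨x, hx⟩).trans_lt (s.equivFin ⟨x, hx⟩).2⟩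

theorem finite_setOf_val_lt (n : ℕ) : {α : IndepY m T r | ∀ t ∈ T, α.1 t < n}.Finite := by
  refine Set.Finite.of_finite_image (f := Subtype.val) ?_ Subtype.val_injective.injOn
  refine (Set.Finite.pi' fun t => Set.finite_lt_nat (max n (r t))).subset ?_
  rintro _ ⟨α, hα, rfl⟩ t
  by_cases ht : t ∈ T
  · exact (hα t ht).trans_le (le_max_left ..)
  · exact (α.2 t ht).trans_le (le_max_right ..)

/-- Up to the action of `Sym(ℕ)` there are only finitely many quadratic moves. -/
theorem exists_finset_swapRel (m : ℕ) (T : Finset (Fin m)) (r : Fin m → ℕ) :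
    ∃ G : Finset ((IndepY m T r →₀ ℕ) × (IndepY m T r →₀ ℕ)), (∀ g ∈ G, SwapRel g.1 g.2) ∧
      ∀ u v : IndepY m T r →₀ ℕ, SwapRel u v → ∃ g ∈ G, ∃ σ : Equiv.Perm ℕ,
        u = g.1.mapDomain (actY m T r σ) ∧ v = g.2.mapDomain (actY m T r σ) := by
  classical
  let low : Set (IndepY m T r) := {α | ∀ t ∈ T, α.1 t < 2 * m}
  let pair : (IndepY m T r × IndepY m T r) × {t // t ∈ T} →
      (IndepY m T r →₀ ℕ) × (IndepY m T r →₀ ℕ) := fun x =>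
    (Finsupp.single x.1.1 1 + Finsupp.single x.1.2 1,
      Finsupp.single (x.1.1.set x.2 x.2.2 (x.1.2.1 x.2)) 1 +
        Finsupp.single (x.1.2.set x.2 x.2.2 (x.1.1.1 x.2)) 1)
  have hfin : (pair '' {x | (x.1.1 ∈ low ∧ x.1.2 ∈ low) ∧ x.1.1.rest = x.1.2.rest}).Finite := by
    refine Set.Finite.image _ ?_
    refine ((((finite_setOf_val_lt (2 * m)).prod (finite_setOf_val_lt (2 * m))).prod
      (Set.finite_univ (α := {t // t ∈ T}))).subset ?_)
    exact fun x hx => ⟨hx.1, Set.mem_univ _⟩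
  refine ⟨hfin.toFinset, fun g hg => ?_, ?_⟩
  · obtain ⟨x, hx, rfl⟩ := hfin.mem_toFinset.1 hg
    exact .swap _ _ _ _ hx.2
  · rintro _ _ ⟨α, β, t, ht, h⟩
    let s := Finset.univ.image α.1 ∪ Finset.univ.image β.1
    have hs : s.card ≤ 2 * m := by
      refine (Finset.card_union_le _ _).trans ?_
      have h1 := Finset.card_image_le (s := Finset.univ) (f := α.1)
      have h2 := Finset.card_image_le (s := Finset.univ) (f := β.1)
      rw [Finset.card_univ, Fintype.card_fin] at h1 h2
      omega
    obtain ⟨σ, hσ⟩ := exists_perm_lt_card s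
    refine ⟨_, hfin.mem_toFinset.2 ⟨((actY m T r σ α, actY m T r σ β), ⟨t, ht⟩),
      ⟨⟨fun t ht => ?_, fun t ht => ?_⟩, by simpa using h⟩, rfl⟩, σ.symm, ?_, ?_⟩
    · rw [actY_val_of_mem _ _ ht]
      exact (hσ _ (by simp [s])).trans_le hs
    · rw [actY_val_of_mem _ _ ht]
      exact (hσ _ (by simp [s])).trans_le hs
    · simp [pair, Finsupp.mapDomain_add, Finsupp.mapDomain_single, actY_symm_actY]
    · simp [pair, Finsupp.mapDomain_add, Finsupp.mapDomain_single, actY_symm_actY, actY_set,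
        actY_val_of_mem _ _ ht]

/-- A congruence containing the quadratic moves and the orbits of a finite basis of the pairs with
equal image contains all pairs with equal image. -/
theorem con_of_indepExponent_eq (hT : ∀ F ∈ 𝓕, (F ∩ T).card ≤ 1)
    {C : AddCon (IndepY m T r →₀ ℕ)} (hC : swapCon m T r ≤ C)
    {G : Finset ((IndepY m T r →₀ ℕ) × (IndepY m T r →₀ ℕ))}
    (hG : ∀ g ∈ G, g ≠ 0)
    (hG' : ∀ p : (IndepY m T r →₀ ℕ) × (IndepY m T r →₀ ℕ),
      indepExponent 𝓕 p.1 = indepExponent 𝓕 p.2 ∧ p ≠ 0 → ∃ g ∈ G, PairLE g p)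
    (hGexp : ∀ g ∈ G, ∀ σ : Equiv.Perm ℕ,
      indepExponent 𝓕 (g.1.mapDomain (actY m T r σ)) =
        indepExponent 𝓕 (g.2.mapDomain (actY m T r σ)))
    (hGC : ∀ g ∈ G, ∀ σ : Equiv.Perm ℕ,
      C (g.1.mapDomain (actY m T r σ)) (g.2.mapDomain (actY m T r σ)))
    (u v : IndepY m T r →₀ ℕ) (h : indepExponent 𝓕 u = indepExponent 𝓕 v) : C u v := by
  induction hd : u.degree + v.degree using Nat.strong_induction_on generalizing u v with
  | _ d ih =>
    by_cases h0 : (u, v) = 0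
    · obtain ⟨rfl, rfl⟩ := Prod.mk.inj h0
      exact C.refl _
    obtain ⟨g, hg, σ, hu, hv⟩ := hG' (u, v) ⟨h, h0⟩
    obtain ⟨c, hc⟩ := hu.exists_swapCon_add
    obtain ⟨e, he⟩ := hv.exists_swapCon_add
    have hce : indepExponent 𝓕 c = indepExponent 𝓕 e := by
      have : indepExponent 𝓕 u = indepExponent 𝓕 v := h
      rw [indepExponent_eq_of_swapCon hT hc, indepExponent_eq_of_swapCon hT he, map_add, map_add, hGexp g hg σ] at this
      exact add_left_cancel this
    have hlt : c.degree + e.degree < d := by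
      have h1 : u.degree = _ := degree_eq_of_swapCon hc
      have h2 : v.degree = _ := degree_eq_of_swapCon he
      rw [map_add, Finsupp.degree_mapDomain] at h1 h2
      have h3 : g.1.degree ≠ 0 ∨ g.2.degree ≠ 0 := by
        by_contra! h3
        exact hG g hg (Prod.ext ((Finsupp.degree_eq_zero_iff _).1 h3.1)
          ((Finsupp.degree_eq_zero_iff _).1 h3.2))
      omega
    have hCu : C u _ := hC hc
    have hCv : C v _ := hC he
    exact C.trans hCu (C.trans (C.add (hGC g hg σ) (ih _ hlt c e hce rfl)) (C.symm hCv))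

end

/-- The Independent Set Theorem of Hillar–Sullivant: if `T` is an independent set of the
hypergraph `𝓕` on `[m]` (each `F ∈ 𝓕` contains at most one element of `T`), then the map
`φ : ℤ[Y] → ℤ[X]`, `y_α ↦ ∏_{F ∈ 𝓕} x_{F,α|_F}`, is `Sym(ℕ)`-equivariant, and `ker φ` is
generated by the union of finitely many `Sym(ℕ)`-orbits of binomials. -/
theorem independent_set_theorem (𝓕 : Finset (Finset (Fin m)))
    (hT : ∀ F ∈ 𝓕, (F ∩ T).card ≤ 1) :
    (∀ (σ : Equiv.Perm ℕ) (f : MvPolynomial (IndepY m T r) ℤ),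
      indepPhi m T r 𝓕 (rename (actY m T r σ) f) =
        rename (actX m T r 𝓕 σ) (indepPhi m T r 𝓕 f)) ∧
    ∃ B : Finset (MvPolynomial (IndepY m T r) ℤ),
      (∀ b ∈ B, b ∈ RingHom.ker (indepPhi m T r 𝓕) ∧
        ∃ u v : IndepY m T r →₀ ℕ, b = monomial u 1 - monomial v 1) ∧
      RingHom.ker (indepPhi m T r 𝓕) =
        Ideal.span {g | ∃ b ∈ B, ∃ σ : Equiv.Perm ℕ, g = rename (actY m T r σ) b} := by
  classical
  refine ⟨indepPhi_rename, ?_⟩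
  have hker : ∀ u v : IndepY m T r →₀ ℕ, (monomial u 1 - monomial v 1 : MvPolynomial _ ℤ) ∈
      RingHom.ker (indepPhi m T r 𝓕) ↔ indepExponent 𝓕 u = indepExponent 𝓕 v := fun u v => by
    rw [RingHom.mem_ker, map_sub, indepPhi_monomial, indepPhi_monomial, sub_eq_zero,
      (monomial_left_injective one_ne_zero).eq_iff]
  obtain ⟨S, hS, hS'⟩ := exists_finset_swapRel m T r
  obtain ⟨G, hG, hG'⟩ := wellQuasiOrdered_pairLE.exists_finset_basis
    fun p : (IndepY m T r →₀ ℕ) × (IndepY m T r →₀ ℕ) =>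
      indepExponent 𝓕 p.1 = indepExponent 𝓕 p.2 ∧ p ≠ 0
  let bin : (IndepY m T r →₀ ℕ) × (IndepY m T r →₀ ℕ) → MvPolynomial (IndepY m T r) ℤ :=
    fun p => monomial p.1 1 - monomial p.2 1
  have hbin : ∀ p ∈ S ∪ G, bin p ∈ RingHom.ker (indepPhi m T r 𝓕) := fun p hp => by
    rw [hker]
    rcases Finset.mem_union.1 hp with hp | hp
    · exact indepExponent_eq_of_swapCon hT (AddConGen.Rel.of _ _ (hS p hp))
    · exact (hG p hp).1
  have hrename : ∀ p (σ : Equiv.Perm ℕ), rename (actY m T r σ) (bin p) =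
      bin (p.1.mapDomain (actY m T r σ), p.2.mapDomain (actY m T r σ)) := fun p σ => by
    simp only [bin, map_sub, rename_monomial]
  have hker_rename : ∀ p ∈ S ∪ G, ∀ σ : Equiv.Perm ℕ,
      rename (actY m T r σ) (bin p) ∈ RingHom.ker (indepPhi m T r 𝓕) := fun p hp σ => by
    rw [RingHom.mem_ker, indepPhi_rename, RingHom.mem_ker.1 (hbin p hp), map_zero]
  refine ⟨(S ∪ G).image bin, ?_, le_antisymm ?_ ?_⟩
  · intro b hb
    obtain ⟨p, hp, rfl⟩ := Finset.mem_image.1 hb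
    exact ⟨hbin p hp, p.1, p.2, rfl⟩
  · have hmem : ∀ p ∈ S ∪ G, ∀ σ : Equiv.Perm ℕ,
        bin (p.1.mapDomain (actY m T r σ), p.2.mapDomain (actY m T r σ)) ∈
          Ideal.span {g | ∃ b ∈ (S ∪ G).image bin, ∃ σ : Equiv.Perm ℕ,
            g = rename (actY m T r σ) b} := fun p hp σ =>
      Ideal.subset_span ⟨bin p, Finset.mem_image_of_mem _ hp, σ, (hrename p σ).symm⟩
    refine ker_indepPhi_le (con_of_indepExponent_eq hT ?_ (fun g hg => (hG g hg).2) hG' ?_ ?_)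
    · refine AddCon.addConGen_le.2 fun u v huv => ?_
      obtain ⟨g, hg, σ, rfl, rfl⟩ := hS' u v huv
      exact hmem g (Finset.mem_union_left _ hg) σ
    · intro g hg σ
      rw [← hker]
      have := hker_rename g (Finset.mem_union_right _ hg) σ
      rwa [hrename] at this
    · exact fun g hg σ => hmem g (Finset.mem_union_right _ hg) σ
  · rw [Ideal.span_le]
    rintro _ ⟨b, hb, σ, rfl⟩
    obtain ⟨p, hp, rfl⟩ := Finset.mem_image.1 hb
    exact hker_rename p hp σ
end

section
/- Let R be a commutative ring with 1 ≠ 0 and let φ be as in the context. For a tuple A = (A_p)_{p∈[N]} of matrices A_p ∈ ℕ^{[k_p]×ℕ}, each with only finitely many nonzero entries, the monomial x^A := ∏_{p∈[N]} ∏_{l∈[k_p]} ∏_{j∈ℕ} x_{p,l,j}^{(A_p)_{l,j}} lies in the image of φ (equivalently, in the multiplicative monoid generated by the monomials φ(y_{p,J})) if and only if A is good, i.e., for every p ∈ [N] all row sums of A_p are equal to some d_p ∈ ℕ and all column sums of A_p are at most d_p. -/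
open MvPolynomial

/-- The index set of the variables `y_{p,J}`, `p ∈ [N]`, `J : [k_p] → ℕ` injective. -/
def YIdx (N : ℕ) (k : Fin N → ℕ) : Type :=
  Σ p : Fin N, {J : Fin (k p) → ℕ // Function.Injective J}

/-- The index set of the variables `x_{p,l,j}`, `p ∈ [N]`, `l ∈ [k_p]`, `j ∈ ℕ`. -/
def XIdxM (N : ℕ) (k : Fin N → ℕ) : Type := Σ p : Fin N, Fin (k p) × ℕ

/-- The monomial map `φ : R[Y] → R[X]`, `y_{p,J} ↦ ∏_{l ∈ [k_p]} x_{p,l,J(l)}`. -/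
noncomputable def matchingPhi (R : Type) [CommRing R] (N : ℕ) (k : Fin N → ℕ) :
    MvPolynomial (YIdx N k) R →ₐ[R] MvPolynomial (XIdxM N k) R :=
  aeval fun y : YIdx N k =>
    ∏ l : Fin (k y.1), (X (⟨y.1, (l, y.2.1 l)⟩ : XIdxM N k) : MvPolynomial (XIdxM N k) R)

/-- A tuple `A = (A_p)_p` of matrices (encoded as one finitely supported exponent vector
on `X`) is good: for every `p` all row sums of `A_p` are equal to some `d_p` and all
column sums of `A_p` are at most `d_p`. -/
def GoodTupleF (N : ℕ) (k : Fin N → ℕ) (A : XIdxM N k →₀ ℕ) : Prop :=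
  ∀ p : Fin N, ∃ d : ℕ,
    (∀ l : Fin (k p), ∑ᶠ j : ℕ, A ⟨p, (l, j)⟩ = d) ∧
    ∀ j : ℕ, (∑ l : Fin (k p), A ⟨p, (l, j)⟩) ≤ d

open Finset in
/-- A nonnegative integer matrix with all row sums equal to `d > 0` and all column sums at most
`d` has a transversal of positive entries that meets every column whose sum is `d`. -/
theorem exists_injective_transversal {ι α : Type*} [Fintype ι] (B : ι → α → ℕ) (C : Finset α)
    {d : ℕ} (hd : 0 < d) (hrow : ∀ i, ∑ j ∈ C, B i j = d) (hcol : ∀ j ∈ C, ∑ i, B i j ≤ d) :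
    ∃ J : ι → α, Function.Injective J ∧ (∀ i, 0 < B i (J i)) ∧
      ∀ j ∈ C, ∑ i, B i j = d → ∃ i, J i = j := by
  classical
  have htot : ∑ j ∈ C, ∑ i, B i j = Fintype.card ι * d := by
    rw [sum_comm]; simp [hrow]
  have hcard : Fintype.card ι ≤ #C := by
    refine Nat.le_of_mul_le_mul_right (htot ▸ ?_) hd
    simpa using sum_le_sum hcol
  let rows (S : Finset C) : Finset ι := univ.filter fun i => ∃ j ∈ S, 0 < B i j
  have hrows (S : Finset C) : ∑ j ∈ S, ∑ i, B i j ≤ #(rows S) * d := by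
    rw [sum_comm]
    calc ∑ i, ∑ j ∈ S, B i j = ∑ i ∈ rows S, ∑ j ∈ S, B i j := by
          refine (sum_subset (subset_univ _) fun i _ hi => ?_).symm
          refine sum_eq_zero fun j hj => ?_
          by_contra h
          exact hi (mem_filter.2 ⟨mem_univ _, j, hj, Nat.pos_of_ne_zero h⟩)
      _ ≤ ∑ i ∈ rows S, d := by
          refine sum_le_sum fun i _ => ?_
          rw [← hrow i, ← sum_coe_sort C]
          exact sum_le_sum_of_subset (subset_univ S)
      _ = #(rows S) * d := by simp
  let t (j : C) : Finset (ι ⊕ Fin (#C - Fintype.card ι)) :=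
    univ.filter fun r => r.elim (fun i => 0 < B i j) fun _ => ∑ i, B i j ≠ d
  have hall : ∀ S : Finset C, #S ≤ #(S.biUnion t) := by
    intro S
    by_cases hS : ∀ j ∈ S, ∑ i, B i j = d
    · have hle : #S ≤ #(rows S) := by
        refine Nat.le_of_mul_le_mul_right ?_ hd
        refine le_trans ?_ (hrows S)
        rw [sum_congr rfl hS]; simp
      refine hle.trans ?_
      rw [← card_map Function.Embedding.inl (s := rows S)]
      refine card_le_card fun r hr => ?_
      simp only [mem_map, rows, mem_filter, mem_univ, true_and] at hr
      obtain ⟨i, ⟨j, hj, hij⟩, rfl⟩ := hr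
      exact mem_biUnion.2 ⟨j, hj, by simpa [t] using hij⟩
    · push Not at hS
      obtain ⟨j₀, hj₀, hne⟩ := hS
      have hcompl : ∑ j ∈ Sᶜ, ∑ i, B i j ≤ #Sᶜ * d := by
        simpa using sum_le_sum fun (j : C) (_ : j ∈ Sᶜ) => hcol j j.2
      have hsplit : ∑ j ∈ S, ∑ i, B i j + ∑ j ∈ Sᶜ, ∑ i, B i j = Fintype.card ι * d := by
        rw [sum_add_sum_compl, ← htot, ← sum_coe_sort C]
      have hle : Fintype.card ι ≤ #(rows S) + #Sᶜ := by
        refine Nat.le_of_mul_le_mul_right ?_ hd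
        have := hrows S
        rw [add_mul]; omega
      have hC : #S + #Sᶜ = #C := by simp
      have hsub : (rows S).disjSum univ ⊆ S.biUnion t := by
        intro r hr
        rcases mem_disjSum.1 hr with ⟨i, hi, rfl⟩ | ⟨i, _, rfl⟩
        · obtain ⟨j, hj, hij⟩ := (mem_filter.1 hi).2
          exact mem_biUnion.2 ⟨j, hj, by simpa [t] using hij⟩
        · exact mem_biUnion.2 ⟨j₀, hj₀, by simpa [t] using hne⟩
      have := card_le_card hsub
      rw [card_disjSum, card_univ, Fintype.card_fin] at this
      omega
  obtain ⟨f, hf, hft⟩ := (all_card_le_biUnion_card_iff_exists_injective t).1 hall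
  have hbij : Function.Bijective f :=
    (Fintype.bijective_iff_injective_and_card f).2 ⟨hf, by simp; omega⟩
  choose g hg using fun i : ι => hbij.2 (Sum.inl i)
  refine ⟨fun i => g i, fun a b hab => ?_, fun i => ?_, fun j hj hjd => ?_⟩
  · have := congrArg f (Subtype.ext hab)
    rw [hg, hg] at this
    exact Sum.inl_injective this
  · have := hft (g i)
    rw [hg] at this
    simpa [t] using this
  · have := hft ⟨j, hj⟩
    rcases h : f ⟨j, hj⟩ with i | i
    · exact ⟨i, congrArg Subtype.val (hf ((hg i).trans h.symm))⟩
    · rw [h] at this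
      simp [t, hjd] at this

/-- The index of the variable `x_{p,l,j}`. -/
def xIdx {N : ℕ} {k : Fin N → ℕ} (p : Fin N) (l : Fin (k p)) (j : ℕ) : XIdxM N k := ⟨p, (l, j)⟩

/-- The exponent vector of the monomial `φ(y_{p,J})`. -/
noncomputable def matchingExp {N : ℕ} {k : Fin N → ℕ} (p : Fin N)
    (J : {J : Fin (k p) → ℕ // Function.Injective J}) : XIdxM N k →₀ ℕ :=
  ∑ l : Fin (k p), Finsupp.single (xIdx p l (J.1 l)) 1

section

variable {N : ℕ} {k : Fin N → ℕ}

theorem xIdx_inj {p : Fin N} {l l' : Fin (k p)} {j j' : ℕ} :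
    (xIdx p l j : XIdxM N k) = xIdx p l' j' ↔ l = l' ∧ j = j' := by
  constructor
  · intro h
    exact Prod.mk.inj (eq_of_heq (Sigma.mk.inj h).2)
  · rintro ⟨rfl, rfl⟩; rfl

theorem xIdx_ne {p q : Fin N} (h : p ≠ q) (l : Fin (k p)) (l' : Fin (k q)) (j j' : ℕ) :
    (xIdx p l j : XIdxM N k) ≠ xIdx q l' j' := fun e => h (congrArg Sigma.fst e)

theorem goodTupleF_iff {A : XIdxM N k →₀ ℕ} :
    GoodTupleF N k A ↔ ∀ p, ∃ d : ℕ, (∀ l, ∑ᶠ j : ℕ, A (xIdx p l j) = d) ∧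
      ∀ j, ∑ l, A (xIdx p l j) ≤ d :=
  Iff.rfl

theorem matchingExp_apply_self (p : Fin N) (J : {J : Fin (k p) → ℕ // Function.Injective J})
    (l : Fin (k p)) (j : ℕ) : matchingExp p J (xIdx p l j) = if J.1 l = j then 1 else 0 := by
  classical
  have key (i : Fin (k p)) : i = l ∧ J.1 i = j ↔ i = l ∧ J.1 l = j :=
    and_congr_right fun h => h ▸ Iff.rfl
  simp only [matchingExp, Finsupp.finsetSum_apply, Finsupp.single_apply, xIdx_inj, key]
  by_cases h : J.1 l = j <;> simp [h]

theorem matchingExp_apply_of_ne {p q : Fin N} (hpq : p ≠ q)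
    (J : {J : Fin (k p) → ℕ // Function.Injective J}) (l : Fin (k q)) (j : ℕ) :
    matchingExp p J (xIdx q l j) = 0 := by
  classical
  simp only [matchingExp, Finsupp.finsetSum_apply, Finsupp.single_apply]
  exact Finset.sum_eq_zero fun i _ => if_neg (xIdx_ne hpq _ _ _ _)

theorem finite_support_row (A : XIdxM N k →₀ ℕ) (p : Fin N) (l : Fin (k p)) :
    (Function.support fun j : ℕ => A (xIdx p l j)).Finite :=
  Set.Finite.preimage (f := fun j : ℕ => (xIdx p l j : XIdxM N k))
    (fun _ _ _ _ h => (xIdx_inj.1 h).2) A.hasFiniteSupport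

theorem finsum_add_apply_row (A B : XIdxM N k →₀ ℕ) (p : Fin N) (l : Fin (k p)) :
    ∑ᶠ j : ℕ, (A + B) (xIdx p l j) =
      ∑ᶠ j : ℕ, A (xIdx p l j) + ∑ᶠ j : ℕ, B (xIdx p l j) := by
  simp only [Finsupp.add_apply]
  exact finsum_add_distrib (finite_support_row A p l) (finite_support_row B p l)

theorem GoodTupleF.zero : GoodTupleF N k 0 :=
  goodTupleF_iff.2 fun _ => ⟨0, by simp, by simp⟩

theorem GoodTupleF.add {A B : XIdxM N k →₀ ℕ} (hA : GoodTupleF N k A) (hB : GoodTupleF N k B) :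
    GoodTupleF N k (A + B) := by
  refine goodTupleF_iff.2 fun p => ?_
  obtain ⟨a, ha, ha'⟩ := goodTupleF_iff.1 hA p
  obtain ⟨b, hb, hb'⟩ := goodTupleF_iff.1 hB p
  refine ⟨a + b, fun l => by rw [finsum_add_apply_row, ha, hb], fun j => ?_⟩
  simp only [Finsupp.add_apply, Finset.sum_add_distrib]
  exact add_le_add (ha' j) (hb' j)

theorem finsum_matchingExp_self (p : Fin N) (J : {J : Fin (k p) → ℕ // Function.Injective J})
    (l : Fin (k p)) : ∑ᶠ j : ℕ, matchingExp p J (xIdx p l j) = 1 := by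
  simp only [matchingExp_apply_self]
  rw [finsum_eq_single _ (J.1 l) fun j hj => if_neg hj.symm, if_pos rfl]

theorem goodTupleF_matchingExp (p : Fin N) (J : {J : Fin (k p) → ℕ // Function.Injective J}) :
    GoodTupleF N k (matchingExp p J) := by
  refine goodTupleF_iff.2 fun q => ?_
  by_cases hq : p = q
  · subst hq
    refine ⟨1, finsum_matchingExp_self p J, fun j => ?_⟩
    simp only [matchingExp_apply_self, Finset.sum_boole, Nat.cast_id]
    refine Finset.card_le_one.2 fun a ha b hb => J.2 ?_
    rw [(Finset.mem_filter.1 ha).2, (Finset.mem_filter.1 hb).2]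
  · exact ⟨0, by simp [matchingExp_apply_of_ne hq], by simp [matchingExp_apply_of_ne hq]⟩

/-- A nonzero good tuple is the sum of the exponent vector of some `φ(y_{p,J})` and a strictly
smaller good tuple. -/
theorem GoodTupleF.exists_eq_matchingExp_add {A : XIdxM N k →₀ ℕ} (hA : GoodTupleF N k A)
    (h0 : A ≠ 0) : ∃ (p : Fin N) (J : {J : Fin (k p) → ℕ // Function.Injective J})
      (B : XIdxM N k →₀ ℕ), GoodTupleF N k B ∧ A = matchingExp p J + B ∧ B < A := by
  classical
  obtain ⟨⟨p, l₀, j₀⟩, hx⟩ := Finsupp.ne_iff.1 h0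
  replace hx : A (xIdx p l₀ j₀) ≠ 0 := hx
  obtain ⟨d, hrow, hcol⟩ := goodTupleF_iff.1 hA p
  have hd : 0 < d := (Nat.pos_of_ne_zero hx).trans_le <|
    (Finset.single_le_sum (f := fun l => A (xIdx p l j₀)) (fun _ _ => Nat.zero_le _)
      (Finset.mem_univ l₀)).trans (hcol j₀)
  let C : Finset ℕ := A.support.image fun x => x.2.2
  have hC {l : Fin (k p)} {j : ℕ} (h : A (xIdx p l j) ≠ 0) : j ∈ C :=
    Finset.mem_image.2 ⟨_, Finsupp.mem_support_iff.2 h, rfl⟩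
  obtain ⟨J, hJ, hpos, htight⟩ := exists_injective_transversal
    (fun (l : Fin (k p)) (j : ℕ) => A (xIdx p l j)) C hd
    (fun l => by rw [← hrow l, finsum_eq_sum_of_support_subset _ fun j hj => hC hj])
    fun j _ => hcol j
  have hy (l : Fin (k p)) (j : ℕ) :
      matchingExp p ⟨J, hJ⟩ (xIdx p l j) = if J l = j then 1 else 0 :=
    matchingExp_apply_self p ⟨J, hJ⟩ l j
  have hle : matchingExp p ⟨J, hJ⟩ ≤ A := by
    rintro ⟨q, l, j⟩
    by_cases hq : p = q
    · subst hq
      refine (hy l j).trans_le ?_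
      split_ifs with h
      · exact h ▸ hpos l
      · exact Nat.zero_le _
    · exact (matchingExp_apply_of_ne hq ⟨J, hJ⟩ l j).trans_le (Nat.zero_le _)
  obtain ⟨B, rfl⟩ := exists_add_of_le hle
  refine ⟨p, ⟨J, hJ⟩, B, goodTupleF_iff.2 fun q => ?_, rfl,
    lt_of_le_of_ne le_add_self fun h => ?_⟩
  · by_cases hq : p = q
    · subst hq
      refine ⟨d - 1, fun l => ?_, fun j => ?_⟩
      · have := hrow l
        rw [finsum_add_apply_row, finsum_matchingExp_self] at this
        omega
      · have hj := hcol j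
        have hsum : ∑ l, (matchingExp p ⟨J, hJ⟩ + B) (xIdx p l j) =
            ∑ l, matchingExp p ⟨J, hJ⟩ (xIdx p l j) + ∑ l, B (xIdx p l j) := by
          simp only [Finsupp.add_apply, Finset.sum_add_distrib]
        by_cases hjd : ∑ l, (matchingExp p ⟨J, hJ⟩ + B) (xIdx p l j) = d
        · obtain ⟨l, -, hl⟩ := Finset.exists_ne_zero_of_sum_ne_zero (hjd.trans_ne hd.ne')
          obtain ⟨i, hi⟩ := htight j (hC hl) hjd
          have : 1 ≤ ∑ l, matchingExp p ⟨J, hJ⟩ (xIdx p l j) := by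
            refine le_trans ?_ (Finset.single_le_sum (fun _ _ => Nat.zero_le _)
              (Finset.mem_univ i))
            rw [hy, if_pos hi]
          omega
        · omega
    · obtain ⟨c, hr, hc⟩ := goodTupleF_iff.1 hA q
      simp only [Finsupp.add_apply, matchingExp_apply_of_ne hq, zero_add] at hr hc
      exact ⟨c, hr, hc⟩
  · have := DFunLike.congr_fun h (xIdx p l₀ (J l₀))
    rw [Finsupp.add_apply, hy, if_pos rfl] at this
    omega

theorem goodTupleF_iff_mem_closure (A : XIdxM N k →₀ ℕ) :
    GoodTupleF N k A ↔
      A ∈ AddSubmonoid.closure (Set.range fun y : YIdx N k => matchingExp y.1 y.2) := by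
  constructor
  · induction A using WellFoundedLT.induction with
    | ind A ih =>
      intro hA
      by_cases h0 : A = 0
      · exact h0 ▸ zero_mem _
      · obtain ⟨p, J, B, hB, hAB, hlt⟩ := hA.exists_eq_matchingExp_add h0
        rw [hAB]
        exact add_mem (AddSubmonoid.subset_closure ⟨⟨p, J⟩, rfl⟩) (ih B hlt hB)
  · intro h
    induction h using AddSubmonoid.closure_induction with
    | mem _ h => obtain ⟨y, rfl⟩ := h; exact goodTupleF_matchingExp y.1 y.2
    | zero => exact GoodTupleF.zero
    | add _ _ _ _ hA hB => exact hA.add hB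

variable (R : Type) [CommRing R]

theorem matchingPhi_X (y : YIdx N k) :
    matchingPhi R N k (X y) = monomial (matchingExp y.1 y.2) 1 := by
  rw [matchingPhi, aeval_X, matchingExp, monomial_sum_one]
  rfl

theorem matchingPhi_monomial (m : YIdx N k →₀ ℕ) (r : R) :
    matchingPhi R N k (monomial m r) =
      monomial (m.sum fun y n => n • matchingExp y.1 y.2) r := by
  rw [monomial_eq, map_mul, Finsupp.prod, map_prod]
  simp only [map_pow, matchingPhi_X, monomial_pow, one_pow]
  rw [← monomial_sum_one, ← algebraMap_eq, AlgHom.commutes, algebraMap_eq, C_mul_monomial, mul_one]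
  rfl

theorem monomial_mem_range_matchingPhi_iff [Nontrivial R] (A : XIdxM N k →₀ ℕ) :
    monomial A (1 : R) ∈ Set.range (matchingPhi R N k) ↔
      A ∈ AddSubmonoid.closure (Set.range fun y : YIdx N k => matchingExp y.1 y.2) := by
  classical
  constructor
  · rintro ⟨f, hf⟩
    have hcoeff := congrArg (coeff A) hf
    rw [f.as_sum, map_sum, coeff_sum, coeff_monomial, if_pos rfl] at hcoeff
    obtain ⟨m, -, hm⟩ := Finset.exists_ne_zero_of_sum_ne_zero (hcoeff.trans_ne one_ne_zero)
    rw [matchingPhi_monomial, coeff_monomial] at hm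
    rw [← (ite_ne_right_iff.1 hm).1]
    exact sum_mem fun y _ => nsmul_mem (AddSubmonoid.subset_closure (Set.mem_range_self y)) _
  · intro h
    change _ ∈ (matchingPhi R N k).range
    induction h using AddSubmonoid.closure_induction with
    | mem _ h => obtain ⟨y, rfl⟩ := h; exact ⟨X y, matchingPhi_X R y⟩
    | zero => exact one_mem _
    | add A B _ _ hA hB =>
      rw [← one_mul (1 : R), ← monomial_mul]
      exact mul_mem hA hB

end

/-- Characterization of the matching monoid: the monomial `x^A` lies in the image of `φ`
if and only if `A` is good. -/
theorem monomial_mem_image_iff_good (R : Type) [CommRing R] [Nontrivial R]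
    (N : ℕ) (hN : 1 ≤ N) (k : Fin N → ℕ) (hk : ∀ p, 1 ≤ k p) (A : XIdxM N k →₀ ℕ) :
    (monomial A (1 : R)) ∈ Set.range (matchingPhi R N k) ↔ GoodTupleF N k A :=
  (monomial_mem_range_matchingPhi_iff R A).trans (goodTupleF_iff_mem_closure A).symm
end

section
/- Fix k ≥ 1. For good matrices A, B ∈ ℕ^{[k]×ℕ}, we have A ≼ B (in the Inc(ℕ)-divisibility order) if and only if there exists π ∈ Inc(ℕ) such that πÃ ≤ B̃ entrywise. -/
/-- `A ∈ ℕ^{[k]×ℕ}` is good of degree `d`: it has finitely many nonzero entries, all row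
sums equal `d`, and every column sum is at most `d`. -/
def IsGood {k : ℕ} (A : Fin k → ℕ → ℕ) (d : ℕ) : Prop :=
  {q : Fin k × ℕ | A q.1 q.2 ≠ 0}.Finite ∧
    (∀ i, ∑ᶠ j, A i j = d) ∧ ∀ j, (∑ i, A i j) ≤ d

/-- The action of a map `π : ℕ → ℕ` on matrices by moving columns: `colShift π A` has
column `A_{·,j}` at position `π(j)` for every `j`, and zero columns at positions outside
the image of `π`. -/
noncomputable def colShift {k : ℕ} (π : ℕ → ℕ) (A : Fin k → ℕ → ℕ) : Fin k → ℕ → ℕ :=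
  fun i => Function.extend π (A i) (fun _ => 0)

/-- The Inc(ℕ)-divisibility order on good matrices: `A ≼ B` iff there is a strictly
increasing `π : ℕ → ℕ` such that `B − πA` is entrywise nonnegative and good. -/
def IncDiv {k : ℕ} (A B : Fin k → ℕ → ℕ) : Prop :=
  ∃ π : ℕ → ℕ, StrictMono π ∧ (∀ i j, colShift π A i j ≤ B i j) ∧
    ∃ d : ℕ, IsGood (fun i j => B i j - colShift π A i j) d

/-- For a good matrix `A` of degree `d`, the matrix `Ã ∈ ℕ^{[k+1]×ℕ}` whose first `k` rows
equal those of `A` and whose last row makes every column sum equal to `d`. -/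
def tilde {k : ℕ} (A : Fin k → ℕ → ℕ) (d : ℕ) : Fin (k + 1) → ℕ → ℕ :=
  fun i j => if h : (i : ℕ) < k then A ⟨i, h⟩ j else d - ∑ i' : Fin k, A i' j

/-- `πÃ`: the matrix with column `Ã_{·,j}` at position `π(j)` for every `j`, and the
trivial column `(0,…,0,d)ᵀ` at every position outside the image of `π`. -/
noncomputable def tildeShift {k : ℕ} (π : ℕ → ℕ) (A : Fin k → ℕ → ℕ) (d : ℕ) :
    Fin (k + 1) → ℕ → ℕ :=
  fun i => Function.extend π (fun j => tilde A d i j)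
    (fun _ => if (i : ℕ) < k then 0 else d)

/-- The trivial columns outside the range of `π` are the columns of `tilde` over the zero
columns of `colShift`. -/
theorem tildeShift_eq_tilde_colShift {k : ℕ} {π : ℕ → ℕ} (hπ : π.Injective)
    (A : Fin k → ℕ → ℕ) (d : ℕ) : tildeShift π A d = tilde (colShift π A) d := by
  ext i j
  by_cases hj : ∃ l, π l = j
  · obtain ⟨l, rfl⟩ := hj
    simp [tildeShift, tilde, colShift, hπ.extend_apply]
  · simp [tildeShift, tilde, colShift, Function.extend_apply' _ _ _ hj]

theorem finsum_extend_zero {α β M : Type*} [AddCommMonoid M] {π : α → β} (hπ : π.Injective)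
    (f : α → M) : ∑ᶠ j, Function.extend π f (fun _ => 0) j = ∑ᶠ j, f j := by
  have h : ∀ j, j ∉ Set.range π → Function.extend π f (fun _ => 0) j = 0 :=
    fun j hj => Function.extend_apply' _ _ _ hj
  rw [← finsum_mem_univ, ← finsum_mem_inter_support, Set.univ_inter,
    ← Set.inter_eq_right.2 (fun j hj => by_contra fun hn => hj (h j hn) :
      Function.support (Function.extend π f (fun _ => 0)) ⊆ Set.range π),
    finsum_mem_inter_support, finsum_mem_range hπ]
  simp [hπ.extend_apply]

theorem IsGood.colShift {k : ℕ} {π : ℕ → ℕ} (hπ : π.Injective) {A : Fin k → ℕ → ℕ} {d : ℕ}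
    (hA : IsGood A d) : IsGood (colShift π A) d := by
  refine ⟨(hA.1.image (Prod.map id π)).subset ?_, fun i => ?_, fun j => ?_⟩
  · rintro ⟨i, j⟩ hq
    by_cases hj : ∃ l, π l = j
    · obtain ⟨l, rfl⟩ := hj
      refine ⟨(i, l), ?_, rfl⟩
      simpa [_root_.colShift, hπ.extend_apply] using hq
    · exact absurd (Function.extend_apply' _ _ _ hj) hq
  · exact (finsum_extend_zero hπ (A i)).trans (hA.2.1 i)
  · by_cases hj : ∃ l, π l = j
    · obtain ⟨l, rfl⟩ := hj
      simpa [_root_.colShift, hπ.extend_apply] using hA.2.2 l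
    · simp [_root_.colShift, Function.extend_apply' _ _ _ hj]

theorem IsGood.finite_support {k : ℕ} {A : Fin k → ℕ → ℕ} {d : ℕ} (hA : IsGood A d)
    (i : Fin k) : (Function.support (A i)).Finite :=
  (hA.1.image Prod.snd).subset fun j hj => ⟨(i, j), hj, rfl⟩

theorem finsum_sub_add_finsum {α : Type*} {f g : α → ℕ} (hg : (Function.support g).Finite)
    (hf : (Function.support f).Finite) (hle : ∀ j, f j ≤ g j) :
    ∑ᶠ j, (g j - f j) + ∑ᶠ j, f j = ∑ᶠ j, g j := by
  rw [← finsum_add_distrib (hg.subset fun j hj h => hj (by simp [h])) hf]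
  exact finsum_congr fun j => Nat.sub_add_cancel (hle j)

theorem tilde_le_tilde_iff {k : ℕ} (A B : Fin k → ℕ → ℕ) (dA dB : ℕ) :
    (∀ i j, tilde A dA i j ≤ tilde B dB i j) ↔
      (∀ i j, A i j ≤ B i j) ∧ ∀ j, dA - ∑ i, A i j ≤ dB - ∑ i, B i j := by
  simp [Fin.forall_fin_succ', tilde]

theorem isGood_sub_iff_tilde_le {k : ℕ} (hk : 1 ≤ k) {A B : Fin k → ℕ → ℕ} {dA dB : ℕ}
    (hA : IsGood A dA) (hB : IsGood B dB) :
    ((∀ i j, A i j ≤ B i j) ∧ ∃ d, IsGood (fun i j => B i j - A i j) d) ↔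
      ∀ i j, tilde A dA i j ≤ tilde B dB i j := by
  rw [tilde_le_tilde_iff, and_congr_right_iff]
  intro hle
  have hrow (i) : ∑ᶠ j, (B i j - A i j) + dA = dB := by
    rw [← hA.2.1 i, ← hB.2.1 i]
    exact finsum_sub_add_finsum (hB.finite_support i) (hA.finite_support i) (hle i)
  have hcol (j) : ∑ i, (B i j - A i j) + ∑ i, A i j = ∑ i, B i j := by
    rw [← Finset.sum_add_distrib]
    exact Finset.sum_congr rfl fun i _ => Nat.sub_add_cancel (hle i j)
  constructor
  · rintro ⟨d, -, hd, hc⟩ j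
    have h1 := hrow ⟨0, hk⟩
    rw [hd ⟨0, hk⟩] at h1
    have h2 := hcol j
    have h3 : ∑ i, (B i j - A i j) ≤ d := hc j
    have h4 := hB.2.2 j
    omega
  · intro h
    refine ⟨dB - dA, hB.1.subset fun q hq h0 => hq (by simp [h0]), fun i => ?_, fun j => ?_⟩
    · exact Nat.eq_sub_of_add_eq (hrow i)
    · have h1 := hrow ⟨0, hk⟩
      have h2 := hcol j
      have h3 := h j
      have h4 := hB.2.2 j
      have h5 := hA.2.2 j
      show ∑ i, (B i j - A i j) ≤ dB - dA
      omega

/-- For good matrices `A, B`, `A ≼ B` in the Inc(ℕ)-divisibility order if and only if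
there exists `π ∈ Inc(ℕ)` such that `πÃ ≤ B̃` entrywise. -/
theorem incDiv_iff_tilde (k : ℕ) (hk : 1 ≤ k) (A B : Fin k → ℕ → ℕ) (dA dB : ℕ)
    (hA : IsGood A dA) (hB : IsGood B dB) :
    IncDiv A B ↔ ∃ π : ℕ → ℕ, StrictMono π ∧
      ∀ i j, tildeShift π A dA i j ≤ tilde B dB i j := by
  refine exists_congr fun π => and_congr_right fun hπ => ?_
  rw [tildeShift_eq_tilde_colShift hπ.injective]
  exact isGood_sub_iff_tilde_le hk (hA.colShift hπ.injective) hB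
end

section
/- Fix k ≥ 1. The partially ordered set (𝓜₀, ≼) of elements of 𝓜 with no bad columns is a well-partial-order. -/
/-- An element of the set 𝓜: a natural number `len` (the length), a matrix `A` with `k+1`
rows and `len` columns of natural numbers, and a degree `d`, such that every column sum of
`A` equals `d` and each of the first `k` row sums of `A` is at most `d`. -/
structure MatM (k : ℕ) where
  len : ℕ
  A : Fin (k + 1) → Fin len → ℕ
  d : ℕ
  colsum : ∀ j, ∑ i, A i j = d
  rowsum : ∀ i : Fin k, ∑ j, A i.castSucc j ≤ d

/-- The partial order ≼ on 𝓜: `X ≼ Y` iff `d_X ≤ d_Y` and there is a strictly increasing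
map `ρ` of column indices with `ρX ≤ Y` entrywise, where `ρX` has column `X_{·,j}` at
position `ρ(j)` and the trivial column `(0,…,0,d_X)ᵀ` at positions outside the image of `ρ`. -/
def MatM.pre {k : ℕ} (X Y : MatM k) : Prop :=
  X.d ≤ Y.d ∧ ∃ ρ : Fin X.len → Fin Y.len, StrictMono ρ ∧
    (∀ i j, X.A i j ≤ Y.A i (ρ j)) ∧
    (∀ j : Fin Y.len, (∀ j', ρ j' ≠ j) → X.d ≤ Y.A (Fin.last k) j)

/-- The number of bad columns of `X`: the `j`-th column is bad if `2·X_{k,j} ≤ d_X`. -/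
def MatM.badCard {k : ℕ} (X : MatM k) : ℕ :=
  (Finset.univ.filter fun j : Fin X.len => 2 * X.A (Fin.last k) j ≤ X.d).card

theorem List.SublistForall₂.exists_strictMono {α β : Type*} {R : α → β → Prop} {m n : ℕ}
    {u : Fin m → α} {v : Fin n → β}
    (h : List.SublistForall₂ R (List.ofFn u) (List.ofFn v)) :
    ∃ ρ : Fin m → Fin n, StrictMono ρ ∧ ∀ j, R (u j) (v (ρ j)) := by
  obtain ⟨l, hl, hsub⟩ := List.sublistForall₂_iff.1 h
  obtain ⟨hlen, hR⟩ := List.forall₂_iff_get.1 hl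
  obtain ⟨e, he⟩ := List.sublist_iff_exists_fin_orderEmbedding_get_eq.1 hsub
  have hm : m = l.length := by simpa using hlen
  have hn : (List.ofFn v).length = n := List.length_ofFn
  refine ⟨fun j => Fin.cast hn (e (Fin.cast hm j)), fun a b hab => e.strictMono hab, fun j => ?_⟩
  have hj := hR j (by simp) (by rw [← hm]; exact j.2)
  have hv := he (Fin.cast hm j)
  simp only [List.get_eq_getElem, List.getElem_ofFn, Fin.val_cast] at hj hv
  rw [hv] at hj
  exact hj

namespace MatM

variable {k : ℕ}

/-- The sum of the first `k` entries of a column. -/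
def defect (X : MatM k) (j : Fin X.len) : ℕ := ∑ i : Fin k, X.A i.castSucc j

/-- The sum of all entries in the first `k` rows. -/
def weight (X : MatM k) : ℕ := ∑ j, X.defect j

theorem defect_add_last (X : MatM k) (j : Fin X.len) :
    X.defect j + X.A (Fin.last k) j = X.d := by
  rw [← X.colsum j, Fin.sum_univ_castSucc, defect]

theorem weight_le (X : MatM k) : X.weight ≤ k * X.d := by
  unfold weight defect
  rw [Finset.sum_comm]
  simpa using Finset.sum_le_card_nsmul Finset.univ _ X.d fun i _ => X.rowsum i

theorem lt_two_mul_last {X : MatM k} (hX : X.badCard = 0) (j : Fin X.len) :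
    X.d < 2 * X.A (Fin.last k) j := by
  rw [badCard, Finset.card_eq_zero, Finset.filter_eq_empty_iff] at hX
  exact not_le.1 (hX (Finset.mem_univ j))

theorem weight_add_defect_le {X Y : MatM k} {ρ : Fin X.len → Fin Y.len}
    (hρ : Function.Injective ρ) (hXY : ∀ i j, X.A i j ≤ Y.A i (ρ j)) {j₀ : Fin Y.len}
    (hj₀ : ∀ j, ρ j ≠ j₀) : X.weight + Y.defect j₀ ≤ Y.weight := by
  have hnot : j₀ ∉ Finset.univ.image ρ := by simpa using hj₀
  calc X.weight + Y.defect j₀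
      ≤ ∑ j, Y.defect (ρ j) + Y.defect j₀ := by
        gcongr
        exact Finset.sum_le_sum fun j _ => Finset.sum_le_sum fun i _ => hXY _ j
    _ = ∑ j ∈ insert j₀ (Finset.univ.image ρ), Y.defect j := by
        rw [Finset.sum_insert hnot, Finset.sum_image hρ.injOn, add_comm]
    _ ≤ Y.weight := Finset.sum_le_sum_of_subset (Finset.subset_univ _)

/-- The sequence of columns of a matrix. -/
def columns (X : MatM k) : List (Fin (k + 1) → ℕ) := List.ofFn fun j i => X.A i j

theorem pre_of_two_mul_le {X Y : MatM k} (hY : Y.badCard = 0) (hd : 2 * X.d ≤ Y.d)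
    (h : List.SublistForall₂ (· ≤ ·) X.columns Y.columns) : X.pre Y := by
  obtain ⟨ρ, hρ, hle⟩ := h.exists_strictMono
  refine ⟨by omega, ρ, hρ, fun i j => hle j i, fun j _ => ?_⟩
  have := lt_two_mul_last hY j
  omega

theorem pre_of_weight_eq {X Y : MatM k} (hd : X.d = Y.d) (hw : X.weight = Y.weight)
    (h : List.SublistForall₂ (· ≤ ·) X.columns Y.columns) : X.pre Y := by
  obtain ⟨ρ, hρ, hle⟩ := h.exists_strictMono
  refine ⟨hd.le, ρ, hρ, fun i j => hle j i, fun j hj => ?_⟩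
  have := weight_add_defect_le hρ.injective (fun i j => hle j i) hj
  have := Y.defect_add_last j
  omega

theorem exists_columns_monotone_subseq (f : ℕ → MatM k) :
    ∃ g : ℕ ↪o ℕ, ∀ m n, m ≤ n →
      List.SublistForall₂ (· ≤ ·) (f (g m)).columns (f (g n)).columns := by
  have hcol : (Set.univ : Set (Fin (k + 1) → ℕ)).PartiallyWellOrderedOn (· ≤ ·) :=
    Set.partiallyWellOrderedOn_univ_iff.2 wellQuasiOrdered_le
  have : IsPreorder (List (Fin (k + 1) → ℕ)) (List.SublistForall₂ (· ≤ ·)) := {}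
  exact (hcol.partiallyWellOrderedOn_sublistForall₂ (· ≤ ·)).exists_monotone_subseq
    (f := fun n => (f n).columns) fun _ _ _ => Set.mem_univ _

end MatM

/-- (𝓜₀, ≼), the set of elements of 𝓜 with no bad columns, is a well-partial-order. -/
theorem matM0_wpo (k : ℕ) (hk : 1 ≤ k) (f : ℕ → {X : MatM k // X.badCard = 0}) :
    ∃ i j : ℕ, i < j ∧ MatM.pre (f i).1 (f j).1 := by
  obtain ⟨g, hg⟩ := MatM.exists_columns_monotone_subseq fun n => (f n).1
  by_cases hbig : ∃ n, 0 < n ∧ 2 * (f (g 0)).1.d ≤ (f (g n)).1.d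
  · obtain ⟨n, hn, hd⟩ := hbig
    exact ⟨g 0, g n, g.strictMono hn, MatM.pre_of_two_mul_le (f (g n)).2 hd (hg 0 n hn.le)⟩
  · push Not at hbig
    let D := 2 * (f (g 0)).1.d
    have hd (n : ℕ) : (f (g (n + 1))).1.d < D := hbig (n + 1) n.succ_pos
    have hw (n : ℕ) : (f (g (n + 1))).1.weight < k * D + 1 :=
      Nat.lt_succ_of_le ((f (g (n + 1))).1.weight_le.trans (Nat.mul_le_mul_left k (hd n).le))
    obtain ⟨m, n, hne, heq⟩ := Finite.exists_ne_map_eq_of_infinite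
      fun n : ℕ => ((⟨_, hd n⟩, ⟨_, hw n⟩) : Fin D × Fin (k * D + 1))
    simp only [Prod.mk.injEq, Fin.mk.injEq] at heq
    wlog hmn : m < n generalizing m n
    · exact this n m hne.symm ⟨heq.1.symm, heq.2.symm⟩ (by omega)
    exact ⟨g (m + 1), g (n + 1), g.strictMono (by omega),
      MatM.pre_of_weight_eq heq.1 heq.2 (hg _ _ (by omega))⟩
end
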